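/- Let C be a Krull-Schmidt, Hom-finite, K-linear triangulated category (K a field) which has Auslander-Reiten triangles and a cluster tilting subcategory T. Then the following statements are equivalent: (1) Ker(g) is generated by {[l_X] | X ∈ Ind(C) \ T[1]}, where g : K_0(C,0) → K_0(C,T) is the canonical projection; (2) Ker(ψ) is generated by {[l_X] | X ∈ Ind(C)}, where ψ : K_0(C,0) → K_0(C) is the canonical epimorphism; (3) C is locally finite. -/

import Mathlib

open CategoryTheory CategoryTheory.Limits Opposite ZeroObject

attribute [local instance] CategoryTheory.Limits.hasBinaryBiproducts_of_finite_biproducts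

universe w v u

noncomputable section

/-- An object of a preadditive category with finite biproducts is *indecomposable* if it is
nonzero and admits no nontrivial direct sum decomposition. -/
def Indec {C : Type u} [Category.{v} C] [Preadditive C] [HasFiniteBiproducts C] (X : C) : Prop :=
  ¬ IsZero X ∧ ∀ (Y Z : C), Nonempty (X ≅ Y ⊞ Z) → IsZero Y ∨ IsZero Z

/-- A preadditive category is *Krull-Schmidt* if every object is (isomorphic to) a finite
biproduct of objects having local endomorphism rings. -/
def IsKrullSchmidt (C : Type u) [Category.{v} C] [Preadditive C] [HasFiniteBiproducts C] : Prop :=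
  ∀ X : C, ∃ (n : ℕ) (f : Fin n → C),
    (∀ i, IsLocalRing (CategoryTheory.End (f i))) ∧ Nonempty (X ≅ ⨁ f)

/-- `C` is *locally finite*: for every indecomposable `A` there are, up to isomorphism, only
finitely many indecomposables `B` with `Hom(A, B) ≠ 0`, and only finitely many indecomposables
`B` with `Hom(B, A) ≠ 0`. -/
def LocFinite (C : Type u) [Category.{v} C] [Preadditive C] [HasFiniteBiproducts C] : Prop :=
  ∀ A : C, Indec A →
    (∃ (n : ℕ) (ind : Fin n → C), ∀ B : C, Indec B → (∃ φ : A ⟶ B, φ ≠ 0) →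
        ∃ i, Nonempty (B ≅ ind i)) ∧
    (∃ (n : ℕ) (ind : Fin n → C), ∀ B : C, Indec B → (∃ φ : B ⟶ A, φ ≠ 0) →
        ∃ i, Nonempty (B ≅ ind i))

/-- `X` is a *dense* subcategory: `add X = C`, i.e. every object of `C` is a direct summand
of an object of `X`. -/
def DenseSub {C : Type u} [Category.{v} C] [Preadditive C] [HasFiniteBiproducts C]
    (X : Set C) : Prop :=
  ∀ A : C, ∃ X₀ ∈ X, ∃ B : C, Nonempty (X₀ ≅ A ⊞ B)

/-- `X` is a full additive subcategory closed under isomorphisms (given as a set of objects). -/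
def AddSub (C : Type u) [Category.{v} C] [Preadditive C] [HasFiniteBiproducts C]
    (X : Set C) : Prop :=
  (0 : C) ∈ X ∧ (∀ {A B : C}, A ∈ X → B ∈ X → (A ⊞ B) ∈ X) ∧
    (∀ {A B : C}, A ∈ X → Nonempty (A ≅ B) → B ∈ X)

section K0ZeroDefs

variable (C : Type u) [Category.{v} C] [Preadditive C] [HasFiniteBiproducts C]

/-- The relations `[A] + [B] - [A ⊞ B]` and `[A] - [B]` for `A ≅ B`, defining `K₀(C, 0)`. -/
def relAdd : Set (FreeAbelianGroup C) :=
  {x | (∃ A B : C,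
          x = FreeAbelianGroup.of A + FreeAbelianGroup.of B - FreeAbelianGroup.of (A ⊞ B)) ∨
       (∃ A B : C, Nonempty (A ≅ B) ∧ x = FreeAbelianGroup.of A - FreeAbelianGroup.of B)}

/-- `K₀(C, 0)`: the free abelian group on the isomorphism classes of objects of `C`. -/
abbrev K0Zero := FreeAbelianGroup C ⧸ AddSubgroup.closure (relAdd C)

/-- The class `[A]` of an object `A` in `K₀(C, 0)`. -/
def clsZero (A : C) : K0Zero C := QuotientAddGroup.mk (FreeAbelianGroup.of A)

end K0ZeroDefs

open CategoryTheory.Pretriangulated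

section TriDefs

variable (C : Type u) [Category.{v} C] [Preadditive C] [HasZeroObject C] [HasShift C ℤ]
  [∀ n : ℤ, (shiftFunctor C n).Additive] [Pretriangulated C] [HasFiniteBiproducts C]

/-- `T` is a cluster tilting subcategory of the triangulated category `C`. -/
structure IsClusterTilting (T : Set C) : Prop where
  sum_mem : ∀ {X Y : C}, X ∈ T → Y ∈ T → (X ⊞ Y) ∈ T
  summand_mem : ∀ {X Y Z : C}, Z ∈ T → Nonempty (Z ≅ X ⊞ Y) → X ∈ T
  contravariantly_finite : ∀ X : C, ∃ T₀ ∈ T, ∃ f : T₀ ⟶ X,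
    ∀ T₁ ∈ T, ∀ g : T₁ ⟶ X, ∃ h : T₁ ⟶ T₀, h ≫ f = g
  covariantly_finite : ∀ X : C, ∃ T₀ ∈ T, ∃ f : X ⟶ T₀,
    ∀ T₁ ∈ T, ∀ g : X ⟶ T₁, ∃ h : T₀ ⟶ T₁, f ≫ h = g
  char_left : ∀ X : C, X ∈ T ↔ ∀ T₀ ∈ T, ∀ φ : T₀ ⟶ X⟦(1 : ℤ)⟧, φ = 0
  char_right : ∀ X : C, X ∈ T ↔ ∀ T₀ ∈ T, ∀ φ : X ⟶ T₀⟦(1 : ℤ)⟧, φ = 0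

/-- `X → Y → Z → X[1]` is an Auslander–Reiten triangle: a distinguished triangle with `X, Z`
indecomposable, first map left almost split and second map right almost split. -/
structure IsARTriangle {X Y Z : C} (f : X ⟶ Y) (g : Y ⟶ Z) (h : Z ⟶ X⟦(1 : ℤ)⟧) : Prop where
  distinguished : Triangle.mk f g h ∈ distTriang C
  indec₁ : Indec X
  indec₃ : Indec Z
  not_section : ¬ ∃ r : Y ⟶ X, f ≫ r = 𝟙 X
  left_almost_split : ∀ {X' : C} (u : X ⟶ X'), (¬ ∃ r : X' ⟶ X, u ≫ r = 𝟙 X) →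
    ∃ v : Y ⟶ X', f ≫ v = u
  not_retraction : ¬ ∃ s : Z ⟶ Y, s ≫ g = 𝟙 Z
  right_almost_split : ∀ {W : C} (u : W ⟶ Z), (¬ ∃ s : Z ⟶ W, s ≫ u = 𝟙 Z) →
    ∃ v : W ⟶ Y, v ≫ g = u

/-- The shifted subcategory `T[1]` (closed under isomorphisms). -/
def shiftSet (T : Set C) : Set C := {W | ∃ t ∈ T, Nonempty (W ≅ t⟦(1 : ℤ)⟧)}

/-- `h` factors through an object of `T[1]`. -/
def FactorsThruShift (T : Set C) {Z X : C} (h : Z ⟶ X⟦(1 : ℤ)⟧) : Prop :=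
  ∃ t ∈ T, ∃ (u : Z ⟶ t⟦(1 : ℤ)⟧) (v : t⟦(1 : ℤ)⟧ ⟶ X⟦(1 : ℤ)⟧), u ≫ v = h

/-- The set of elements `[X] + [Z] - [Y]` of `K₀(C, 0)` for all distinguished triangles. -/
def triRel : Set (K0Zero C) :=
  {x | ∃ T : Triangle C, T ∈ (distTriang C) ∧
        x = clsZero C T.obj₁ + clsZero C T.obj₃ - clsZero C T.obj₂}

/-- The Grothendieck group `K₀(C)` of the triangulated category `C`. -/
abbrev K0Tri := K0Zero C ⧸ AddSubgroup.closure (triRel C)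

/-- The canonical epimorphism `ψ : K₀(C, 0) → K₀(C)`. -/
def psiTri : K0Zero C →+ K0Tri C := QuotientAddGroup.mk' _

/-- The class `[A]` of an object `A` in `K₀(C)`. -/
def k0clsTri (A : C) : K0Tri C := psiTri C (clsZero C A)

/-- The relations `[X] + [Z] - [Y]` for triangles `X → Y → Z --h--> X[1]` with `h` factoring
through an object of `T[1]`. -/
def relTriRel (T : Set C) : Set (K0Zero C) :=
  {x | ∃ Tr : Triangle C, Tr ∈ (distTriang C) ∧ FactorsThruShift C T Tr.mor₃ ∧
        x = clsZero C Tr.obj₁ + clsZero C Tr.obj₃ - clsZero C Tr.obj₂}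

/-- The relative Grothendieck group `K₀(C, T)`. -/
abbrev K0RelTri (T : Set C) := K0Zero C ⧸ AddSubgroup.closure (relTriRel C T)

/-- The canonical projection `g : K₀(C, 0) → K₀(C, T)`. -/
def gProj (T : Set C) : K0Zero C →+ K0RelTri C T := QuotientAddGroup.mk' _

/-- The set of elements `[δ] = [X] + [Z] - [Y]` of `K₀(C, 0)` arising from Auslander–Reiten
triangles `X → Y → Z → X[1]`; for the AR triangle starting at `X` this is `[l_X]`. -/
def arRelTri : Set (K0Zero C) :=
  {x | ∃ (X Y Z : C) (f : X ⟶ Y) (g : Y ⟶ Z) (h : Z ⟶ X⟦(1 : ℤ)⟧),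
        IsARTriangle C f g h ∧ x = clsZero C X + clsZero C Z - clsZero C Y}

/-- The set of elements `[l_X]` for `X ∈ Ind(C) \ T[1]`. -/
def arRelTriOff (T : Set C) : Set (K0Zero C) :=
  {x | ∃ (X Y Z : C) (f : X ⟶ Y) (g : Y ⟶ Z) (h : Z ⟶ X⟦(1 : ℤ)⟧),
        IsARTriangle C f g h ∧ X ∉ shiftSet C T ∧
        x = clsZero C X + clsZero C Z - clsZero C Y}

/-- `C` has Auslander–Reiten triangles: every indecomposable `X` admits an Auslander–Reiten
triangle `X → Y → τ⁻¹X → X[1]`. -/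
def HasARTriangles : Prop :=
  ∀ X : C, Indec X →
    ∃ (Y Z : C) (f : X ⟶ Y) (g : Y ⟶ Z) (h : Z ⟶ X⟦(1 : ℤ)⟧), IsARTriangle C f g h

/-- `add T₀`: the objects isomorphic to direct summands of finite direct sums of copies
of `T₀`. -/
def addSet (T₀ : C) : Set C :=
  {X | ∃ (n : ℕ) (Y : C), Nonempty ((⨁ fun _ : Fin n => T₀) ≅ X ⊞ Y)}

/-- `Ind(C)` is finite: there are finitely many indecomposables up to isomorphism. -/
def FinitelyManyIndec : Prop :=
  ∃ (n : ℕ) (ind : Fin n → C), ∀ X : C, Indec X → ∃ i, Nonempty (X ≅ ind i)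

end TriDefs

set_option linter.unusedSectionVars false
section Basic1

variable {C : Type u} [Category.{v} C] [Preadditive C] [HasFiniteBiproducts C]

lemma indec_of_local (X : C) (h : IsLocalRing (CategoryTheory.End X)) : Indec X := by
  constructor
  · intro hz
    have : (1 : CategoryTheory.End X) = 0 := hz.eq_of_src _ _
    exact one_ne_zero this
  · rintro Y Z ⟨e⟩
    let a : CategoryTheory.End X := e.hom ≫ biprod.fst ≫ biprod.inl ≫ e.inv
    let b : CategoryTheory.End X := e.hom ≫ biprod.snd ≫ biprod.inr ≫ e.inv
    have hab : a + b = 1 := by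
      change e.hom ≫ biprod.fst ≫ biprod.inl ≫ e.inv + e.hom ≫ biprod.snd ≫ biprod.inr ≫ e.inv = 𝟙 X
      have := biprod.total (X := Y) (Y := Z)
      rw [← Preadditive.comp_add, ← Category.assoc, ← Category.assoc biprod.snd,
        ← Preadditive.add_comp, this]
      simp
    rcases IsLocalRing.isUnit_or_isUnit_of_add_one hab with hu | hu
    · right
      have hi : IsIso (e.hom ≫ biprod.fst ≫ biprod.inl ≫ e.inv) :=
        (CategoryTheory.isUnit_iff_isIso a).1 hu
      have h0 : (biprod.inr ≫ e.inv) ≫ (e.hom ≫ biprod.fst ≫ biprod.inl ≫ e.inv) = (0 : Z ⟶ X) := by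
        simp
      have h1 : (biprod.inr ≫ e.inv : Z ⟶ X) = 0 := by
        rw [← cancel_mono (e.hom ≫ biprod.fst ≫ biprod.inl ≫ e.inv), h0, zero_comp]
      rw [IsZero.iff_id_eq_zero]
      calc 𝟙 Z = (biprod.inr ≫ e.inv) ≫ e.hom ≫ biprod.snd := by simp
        _ = 0 := by rw [h1, zero_comp]
    · left
      have hi : IsIso (e.hom ≫ biprod.snd ≫ biprod.inr ≫ e.inv) :=
        (CategoryTheory.isUnit_iff_isIso b).1 hu
      have h0 : (biprod.inl ≫ e.inv) ≫ (e.hom ≫ biprod.snd ≫ biprod.inr ≫ e.inv) = (0 : Y ⟶ X) := by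
        simp
      have h1 : (biprod.inl ≫ e.inv : Y ⟶ X) = 0 := by
        rw [← cancel_mono (e.hom ≫ biprod.snd ≫ biprod.inr ≫ e.inv), h0, zero_comp]
      rw [IsZero.iff_id_eq_zero]
      calc 𝟙 Y = (biprod.inl ≫ e.inv) ≫ e.hom ≫ biprod.fst := by simp
        _ = 0 := by rw [h1, zero_comp]

/-- Decomposition of an object into objects with local endomorphism rings. -/
lemma ks_decomp_local (hKS : IsKrullSchmidt C) (X : C) :
    ∃ (n : ℕ) (f : Fin n → C) (ι : ∀ i, f i ⟶ X) (π : ∀ i, X ⟶ f i),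
      (∀ i, IsLocalRing (CategoryTheory.End (f i))) ∧ (∀ i, ι i ≫ π i = 𝟙 _) ∧
      ∑ i, π i ≫ ι i = 𝟙 X := by
  obtain ⟨n, f, hf, ⟨e⟩⟩ := hKS X
  refine ⟨n, f, fun i => biproduct.ι f i ≫ e.inv, fun i => e.hom ≫ biproduct.π f i, hf, ?_, ?_⟩
  · intro i; simp
  · have := biproduct.total (f := f)
    calc ∑ i, (e.hom ≫ biproduct.π f i) ≫ biproduct.ι f i ≫ e.inv
        = e.hom ≫ (∑ i, biproduct.π f i ≫ biproduct.ι f i) ≫ e.inv := by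
          rw [Preadditive.sum_comp, Preadditive.comp_sum]; simp
      _ = 𝟙 X := by rw [this]; simp

lemma ks_decomp (hKS : IsKrullSchmidt C) (X : C) :
    ∃ (n : ℕ) (f : Fin n → C) (ι : ∀ i, f i ⟶ X) (π : ∀ i, X ⟶ f i),
      (∀ i, Indec (f i)) ∧ (∀ i, ι i ≫ π i = 𝟙 _) ∧
      ∑ i, π i ≫ ι i = 𝟙 X := by
  obtain ⟨n, f, ι, π, h1, h2, h3⟩ := ks_decomp_local hKS X
  exact ⟨n, f, ι, π, fun i => indec_of_local _ (h1 i), h2, h3⟩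

/-- Splitting data: `X` is a biproduct of `P` (via `k, ρ`) and `Q` (via `i, p`). -/
structure Spl {P X Q : C} (k : P ⟶ X) (ρ : X ⟶ P) (i : Q ⟶ X) (p : X ⟶ Q) : Prop where
  kρ : k ≫ ρ = 𝟙 P
  ip : i ≫ p = 𝟙 Q
  iρ : i ≫ ρ = 0
  kp : k ≫ p = 0
  tot : ρ ≫ k + p ≫ i = 𝟙 X

lemma Spl.iso {P X Q : C} {k : P ⟶ X} {ρ : X ⟶ P} {i : Q ⟶ X} {p : X ⟶ Q}
    (h : Spl k ρ i p) : Nonempty (X ≅ P ⊞ Q) :=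
  ⟨{ hom := biprod.lift ρ p
     inv := biprod.desc k i
     hom_inv_id := by rw [biprod.lift_desc, h.tot]
     inv_hom_id := by
      ext <;> simp [h.kρ, h.ip, h.iρ, h.kp] }⟩

lemma isIso_one_add_swap {X Y : C} (a : X ⟶ Y) (b : Y ⟶ X) (h : IsIso (𝟙 X + a ≫ b)) :
    IsIso (𝟙 Y + b ≫ a) := by
  let θ := inv (𝟙 X + a ≫ b)
  have h1 : θ + a ≫ b ≫ θ = 𝟙 X := by
    have : (𝟙 X + a ≫ b) ≫ θ = 𝟙 X := IsIso.hom_inv_id _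
    simpa [Preadditive.add_comp] using this
  have h2 : θ + θ ≫ a ≫ b = 𝟙 X := by
    have : θ ≫ (𝟙 X + a ≫ b) = 𝟙 X := IsIso.inv_hom_id _
    simpa [Preadditive.comp_add] using this
  refine ⟨𝟙 Y - b ≫ θ ≫ a, ?_, ?_⟩
  · have e1 : (b ≫ a) ≫ b ≫ θ ≫ a = b ≫ (a ≫ b ≫ θ) ≫ a := by simp
    rw [Preadditive.add_comp, Preadditive.comp_sub, Preadditive.comp_sub, e1,
      eq_sub_of_add_eq' h1]
    simp
  · have e1 : (b ≫ θ ≫ a) ≫ b ≫ a = b ≫ (θ ≫ a ≫ b) ≫ a := by simp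
    rw [Preadditive.sub_comp, Preadditive.comp_add, Preadditive.comp_add, e1,
      eq_sub_of_add_eq' h2]
    simp

end Basic1

section Basic2

variable {C : Type u} [Category.{v} C] [Preadditive C] [HasZeroObject C] [HasShift C ℤ]
  [∀ n : ℤ, (shiftFunctor C n).Additive] [Pretriangulated C] [HasFiniteBiproducts C]

lemma dt_comp12 {X Y Z : C} {f : X ⟶ Y} {g : Y ⟶ Z} {h : Z ⟶ X⟦(1 : ℤ)⟧}
    (hd : Triangle.mk f g h ∈ distTriang C) : f ≫ g = 0 := comp_distTriang_mor_zero₁₂ _ hd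

lemma dt_comp23 {X Y Z : C} {f : X ⟶ Y} {g : Y ⟶ Z} {h : Z ⟶ X⟦(1 : ℤ)⟧}
    (hd : Triangle.mk f g h ∈ distTriang C) : g ≫ h = 0 := comp_distTriang_mor_zero₂₃ _ hd

lemma dt_comp31 {X Y Z : C} {f : X ⟶ Y} {g : Y ⟶ Z} {h : Z ⟶ X⟦(1 : ℤ)⟧}
    (hd : Triangle.mk f g h ∈ distTriang C) : h ≫ f⟦(1 : ℤ)⟧' = 0 :=
  comp_distTriang_mor_zero₃₁ _ hd

lemma dt_yo2 {X Y Z W : C} {f : X ⟶ Y} {g : Y ⟶ Z} {h : Z ⟶ X⟦(1 : ℤ)⟧}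
    (hd : Triangle.mk f g h ∈ distTriang C) (a : Y ⟶ W) (ha : f ≫ a = 0) :
    ∃ b : Z ⟶ W, a = g ≫ b := Triangle.yoneda_exact₂ _ hd a ha

lemma dt_yo3 {X Y Z W : C} {f : X ⟶ Y} {g : Y ⟶ Z} {h : Z ⟶ X⟦(1 : ℤ)⟧}
    (hd : Triangle.mk f g h ∈ distTriang C) (a : Z ⟶ W) (ha : g ≫ a = 0) :
    ∃ b : X⟦(1 : ℤ)⟧ ⟶ W, a = h ≫ b := Triangle.yoneda_exact₃ _ hd a ha

lemma dt_co2 {X Y Z W : C} {f : X ⟶ Y} {g : Y ⟶ Z} {h : Z ⟶ X⟦(1 : ℤ)⟧}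
    (hd : Triangle.mk f g h ∈ distTriang C) (a : W ⟶ Y) (ha : a ≫ g = 0) :
    ∃ b : W ⟶ X, a = b ≫ f := Triangle.coyoneda_exact₂ _ hd a ha

lemma dt_co3 {X Y Z W : C} {f : X ⟶ Y} {g : Y ⟶ Z} {h : Z ⟶ X⟦(1 : ℤ)⟧}
    (hd : Triangle.mk f g h ∈ distTriang C) (a : W ⟶ Z) (ha : a ≫ h = 0) :
    ∃ b : W ⟶ Y, a = b ≫ g := Triangle.coyoneda_exact₃ _ hd a ha

lemma dt_co1 {X Y Z W : C} {f : X ⟶ Y} {g : Y ⟶ Z} {h : Z ⟶ X⟦(1 : ℤ)⟧}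
    (hd : Triangle.mk f g h ∈ distTriang C) (a : W ⟶ X⟦(1 : ℤ)⟧) (ha : a ≫ f⟦(1 : ℤ)⟧' = 0) :
    ∃ b : W ⟶ Z, a = b ≫ h := Triangle.coyoneda_exact₁ _ hd a ha

lemma dt_mor2 {X Y Z X' Y' Z' : C} {f : X ⟶ Y} {g : Y ⟶ Z} {h : Z ⟶ X⟦(1 : ℤ)⟧}
    {f' : X' ⟶ Y'} {g' : Y' ⟶ Z'} {h' : Z' ⟶ X'⟦(1 : ℤ)⟧}
    (hd : Triangle.mk f g h ∈ distTriang C) (hd' : Triangle.mk f' g' h' ∈ distTriang C)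
    (a : X ⟶ X') (c : Z ⟶ Z') (hac : h ≫ a⟦(1 : ℤ)⟧' = c ≫ h') :
    ∃ b : Y ⟶ Y', f ≫ b = a ≫ f' ∧ g ≫ c = b ≫ g' :=
  complete_distinguished_triangle_morphism₂ _ _ hd hd' a c hac

lemma dt_cone {X Y : C} (f : X ⟶ Y) : ∃ (Z : C) (g : Y ⟶ Z) (h : Z ⟶ X⟦(1 : ℤ)⟧),
    Triangle.mk f g h ∈ distTriang C := distinguished_cocone_triangle f

lemma dt_ofconn {X Z : C} (h : Z ⟶ X⟦(1 : ℤ)⟧) : ∃ (Y : C) (f : X ⟶ Y) (g : Y ⟶ Z),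
    Triangle.mk f g h ∈ distTriang C := distinguished_cocone_triangle₂ h

lemma dt_id (V : C) : Triangle.mk (𝟙 V) (0 : V ⟶ 0) 0 ∈ distTriang C :=
  contractible_distinguished V

lemma dt_ext {X Y Z V : C} {f : X ⟶ Y} {g : Y ⟶ Z} {h : Z ⟶ X⟦(1 : ℤ)⟧}
    (hd : Triangle.mk f g h ∈ distTriang C) (r : X ⟶ V) (hr : h ≫ r⟦(1 : ℤ)⟧' = 0) :
    ∃ b : Y ⟶ V, f ≫ b = r := by
  obtain ⟨b, hb, -⟩ := dt_mor2 hd (dt_id V) r 0 (by rw [hr, comp_zero])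
  exact ⟨b, by rw [hb]; simp⟩

lemma dt_ext_iff {X Y Z V : C} {f : X ⟶ Y} {g : Y ⟶ Z} {h : Z ⟶ X⟦(1 : ℤ)⟧}
    (hd : Triangle.mk f g h ∈ distTriang C) (r : X ⟶ V) :
    h ≫ r⟦(1 : ℤ)⟧' = 0 ↔ ∃ b : Y ⟶ V, f ≫ b = r := by
  refine ⟨dt_ext hd r, ?_⟩
  rintro ⟨b, rfl⟩
  rw [Functor.map_comp, reassoc_of% (dt_comp31 hd), zero_comp]

lemma shift_zero_of {X Y : C} {r : X ⟶ Y} (hr : r⟦(1 : ℤ)⟧' = 0) : r = 0 := by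
  apply (shiftFunctor C (1 : ℤ)).map_injective
  rw [hr, Functor.map_zero]

lemma exists_spl {P X : C} (k : P ⟶ X) (ρ : X ⟶ P) (hk : k ≫ ρ = 𝟙 P) :
    ∃ (Q : C) (i : Q ⟶ X) (p : X ⟶ Q), Spl k ρ i p := by
  obtain ⟨Q, g, h, hd⟩ := dt_cone k
  have hkg : k ≫ g = 0 := dt_comp12 hd
  have hhk : h ≫ k⟦(1 : ℤ)⟧' = 0 := dt_comp31 hd
  have hh : h = 0 := by
    calc h = h ≫ (k ≫ ρ)⟦(1 : ℤ)⟧' := by rw [hk]; simp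
      _ = (h ≫ k⟦(1 : ℤ)⟧') ≫ ρ⟦(1 : ℤ)⟧' := by simp
      _ = 0 := by rw [hhk, zero_comp]
  have gepi : ∀ {W : C} (a : Q ⟶ W), g ≫ a = 0 → a = 0 := by
    intro W a ha
    obtain ⟨b, hb⟩ := dt_yo3 hd a ha
    rw [hb, hh, zero_comp]
  obtain ⟨i, hi⟩ := dt_yo2 hd (𝟙 X - ρ ≫ k) (by
    rw [Preadditive.comp_sub, reassoc_of% hk]; simp)
  refine ⟨Q, i, g, hk, ?_, ?_, hkg, ?_⟩
  · refine sub_eq_zero.1 (gepi _ ?_)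
    rw [Preadditive.comp_sub, ← Category.assoc, ← hi, Preadditive.sub_comp, Category.assoc, hkg]; simp
  · apply gepi
    rw [← Category.assoc, ← hi, Preadditive.sub_comp, Category.assoc, hk]; simp
  · rw [← hi]; abel

lemma indec_split {B Z : C} (hB : Indec B) (hZ : ¬ IsZero Z) (s : Z ⟶ B) (r : B ⟶ Z)
    (hs : s ≫ r = 𝟙 Z) : r ≫ s = 𝟙 B := by
  obtain ⟨Q, i, p, h⟩ := exists_spl s r hs
  rcases hB.2 Z Q h.iso with h0 | h0
  · exact absurd h0 hZ
  · have := h.tot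
    rw [h0.eq_of_src i 0, comp_zero, add_zero] at this
    exact this

lemma indec_iso_of_split {B Z : C} (hB : Indec B) (hZ : ¬ IsZero Z) (s : Z ⟶ B) (r : B ⟶ Z)
    (hs : s ≫ r = 𝟙 Z) : Nonempty (B ≅ Z) :=
  ⟨⟨r, s, indec_split hB hZ s r hs, hs⟩⟩

lemma indec_iso_or (hKS : IsKrullSchmidt C) {X : C} (hX : Indec X) (x y : X ⟶ X)
    (hxy : x + y = 𝟙 X) : IsIso x ∨ IsIso y := by
  obtain ⟨n, f, ι, π, h1, h2, h3⟩ := ks_decomp_local hKS X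
  have : Nonempty (Fin n) := by
    by_contra hn
    rw [not_nonempty_iff] at hn
    apply hX.1
    rw [IsZero.iff_id_eq_zero, ← h3]
    simp
  obtain ⟨i⟩ := this
  have hnz := (indec_of_local _ (h1 i)).1
  have e : X ≅ f i := ⟨π i, ι i, indec_split hX hnz _ _ (h2 i), h2 i⟩
  have := h1 i
  let a : CategoryTheory.End (f i) := e.inv ≫ x ≫ e.hom
  let b : CategoryTheory.End (f i) := e.inv ≫ y ≫ e.hom
  have hab : a + b = 1 := by
    change e.inv ≫ x ≫ e.hom + e.inv ≫ y ≫ e.hom = 𝟙 (f i)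
    rw [← Preadditive.comp_add, ← Preadditive.add_comp, hxy]
    simp
  rcases IsLocalRing.isUnit_or_isUnit_of_add_one hab with h | h
  · left
    have : IsIso (e.inv ≫ x ≫ e.hom) := (CategoryTheory.isUnit_iff_isIso a).1 h
    have h2 : x = e.hom ≫ (e.inv ≫ x ≫ e.hom) ≫ e.inv := by simp
    rw [h2]; infer_instance
  · right
    have : IsIso (e.inv ≫ y ≫ e.hom) := (CategoryTheory.isUnit_iff_isIso b).1 h
    have h2 : y = e.hom ≫ (e.inv ≫ y ≫ e.hom) ≫ e.inv := by simp
    rw [h2]; infer_instance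

/-- If `x = a ≫ b` with `a` not split mono, then `1 + a ≫ b` is an isomorphism. -/
lemma isIso_one_add (hKS : IsKrullSchmidt C) {X Y : C} (hX : Indec X) (a : X ⟶ Y) (b : Y ⟶ X)
    (ha : ¬ ∃ r : Y ⟶ X, a ≫ r = 𝟙 X) : IsIso (𝟙 X + a ≫ b) := by
  rcases indec_iso_or hKS hX (𝟙 X + a ≫ b) (-(a ≫ b)) (by abel) with h | h
  · exact h
  · exfalso
    apply ha
    refine ⟨-(b ≫ inv (-(a ≫ b))), ?_⟩
    have := IsIso.hom_inv_id (-(a ≫ b))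
    rw [Preadditive.comp_neg, ← Category.assoc, ← Preadditive.neg_comp]; exact this

end Basic2

set_option linter.unusedSectionVars false
section LemA

variable {C : Type u} [Category.{v} C] [Preadditive C] [HasZeroObject C] [HasShift C ℤ]
  [∀ n : ℤ, (shiftFunctor C n).Additive] [Pretriangulated C] [HasFiniteBiproducts C]

lemma iso_of_bij {B D : C} (r : B ⟶ D) (inj : ∀ (Q : C) (w : Q ⟶ B), w ≫ r = 0 → w = 0)
    (surj : ∀ (Q : C) (q : Q ⟶ D), ∃ w : Q ⟶ B, w ≫ r = q) : Nonempty (B ≅ D) := by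
  obtain ⟨s, hs⟩ := surj D (𝟙 D)
  refine ⟨⟨r, s, ?_, hs⟩⟩
  refine sub_eq_zero.1 (inj _ _ ?_)
  rw [Preadditive.sub_comp, Category.assoc, hs]; simp

lemma isIso_of_two {X : C} (s t : X ⟶ X) (h1 : IsIso (s ≫ t)) (h2 : IsIso (t ≫ s)) : IsIso s := by
  refine ⟨t ≫ inv (s ≫ t), ?_, ?_⟩
  · rw [← Category.assoc, IsIso.hom_inv_id]
  · have e1 : s ≫ (t ≫ inv (s ≫ t)) = 𝟙 X := by rw [← Category.assoc, IsIso.hom_inv_id]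
    have e2 : (inv (t ≫ s) ≫ t) ≫ s = 𝟙 X := by rw [Category.assoc, IsIso.inv_hom_id]
    have e3 : t ≫ inv (s ≫ t) = inv (t ≫ s) ≫ t := by
      calc t ≫ inv (s ≫ t) = ((inv (t ≫ s) ≫ t) ≫ s) ≫ (t ≫ inv (s ≫ t)) := by rw [e2]; simp
        _ = (inv (t ≫ s) ≫ t) ≫ (s ≫ (t ≫ inv (s ≫ t))) := by rw [Category.assoc]
        _ = _ := by rw [e1]; simp
    rw [e3, e2]

lemma ar_conn_ne {V E U : C} {α : V ⟶ E} {β : E ⟶ U} {κ : U ⟶ V⟦(1 : ℤ)⟧}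
    (ar : IsARTriangle C α β κ) : κ ≠ 0 := by
  intro h
  obtain ⟨b, hb⟩ := dt_co3 ar.distinguished (𝟙 U) (by rw [h, comp_zero])
  exact ar.not_retraction ⟨b, hb.symm⟩

lemma ar_pre_zero {V E U W : C} {α : V ⟶ E} {β : E ⟶ U} {κ : U ⟶ V⟦(1 : ℤ)⟧}
    (ar : IsARTriangle C α β κ) (a : W ⟶ U) (ha : ¬ ∃ s : U ⟶ W, s ≫ a = 𝟙 U) : a ≫ κ = 0 := by
  obtain ⟨b, rfl⟩ := ar.right_almost_split a ha
  rw [Category.assoc, dt_comp23 ar.distinguished, comp_zero]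

lemma ar_post_zero {V E U W : C} {α : V ⟶ E} {β : E ⟶ U} {κ : U ⟶ V⟦(1 : ℤ)⟧}
    (ar : IsARTriangle C α β κ) (a : V ⟶ W) (ha : ¬ ∃ s : W ⟶ V, a ≫ s = 𝟙 V) :
    κ ≫ a⟦(1 : ℤ)⟧' = 0 := by
  rw [dt_ext_iff ar.distinguished]
  exact ar.left_almost_split a ha

lemma ar_right_minimal (hKS : IsKrullSchmidt C) {V E U : C} {α : V ⟶ E} {β : E ⟶ U}
    {κ : U ⟶ V⟦(1 : ℤ)⟧} (ar : IsARTriangle C α β κ) (x : E ⟶ E) (hx : x ≫ β = β) : IsIso x := by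
  obtain ⟨n, hn⟩ := dt_co2 ar.distinguished (x - 𝟙 E) (by rw [Preadditive.sub_comp, hx]; simp)
  have h1 := isIso_one_add hKS ar.indec₁ α n ar.not_section
  have h2 := isIso_one_add_swap α n h1
  have : x = 𝟙 E + n ≫ α := by rw [← hn]; abel
  rw [this]; exact h2

lemma lemA (hKS : IsKrullSchmidt C) {X Y Z V E U Z1 B : C} {f : X ⟶ Y} {g : Y ⟶ Z}
    {h : Z ⟶ X⟦(1 : ℤ)⟧} (hd : Triangle.mk f g h ∈ distTriang C)
    {α : V ⟶ E} {β : E ⟶ U} {κ : U ⟶ V⟦(1 : ℤ)⟧} (ar : IsARTriangle C α β κ)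
    (v : X ⟶ V) {ω : Z ⟶ U} {k' : U ⟶ Z} {i : Z1 ⟶ Z} {p : Z ⟶ Z1} (spl : Spl k' ω i p)
    (hv : h ≫ v⟦(1 : ℤ)⟧' = ω ≫ κ) (hk : ¬ ∃ ρ, (k' ≫ h) ≫ ρ = 𝟙 U)
    (fB : X ⟶ B) (π : B ⟶ Z1 ⊞ E)
    (hdB : Triangle.mk fB π (biprod.desc i (β ≫ k') ≫ h) ∈ distTriang C) :
    Nonempty (B ≅ Y ⊞ V) := by
  obtain ⟨c, hc⟩ : ∃ c : Z1 ⊞ E ⟶ Z, c = biprod.desc i (β ≫ k') := ⟨_, rfl⟩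
  rw [← hc] at hdB
  have hc1 : c = biprod.fst ≫ i + biprod.snd ≫ β ≫ k' := by
    rw [hc]; ext <;> simp
  have hcl : biprod.inl ≫ c = i := by rw [hc]; simp
  have hcr : biprod.inr ≫ c = β ≫ k' := by rw [hc]; simp
  have hcω : c ≫ ω = biprod.snd ≫ β := by
    rw [hc1, Preadditive.add_comp, Category.assoc, Category.assoc, Category.assoc, spl.iρ, spl.kρ]
    simp
  have hcp : c ≫ p = biprod.fst := by
    rw [hc1, Preadditive.add_comp, Category.assoc, Category.assoc, Category.assoc, spl.ip, spl.kp]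
    simp
  have hαβ := dt_comp12 ar.distinguished
  have hβκ := dt_comp23 ar.distinguished
  have hfg := dt_comp12 hd
  have hgh := dt_comp23 hd
  have hhf := dt_comp31 hd
  -- r1, r2, y
  obtain ⟨r1, hr1, hr1'⟩ := dt_mor2 hdB hd (𝟙 X) c (by simp)
  rw [Category.id_comp] at hr1
  obtain ⟨r2, hr2⟩ := dt_ext hdB v (by
    rw [Category.assoc, hv, ← Category.assoc, hcω, Category.assoc, hβκ, comp_zero])
  obtain ⟨y, hy, hy'⟩ := dt_mor2 hd ar.distinguished v ω hv
  obtain ⟨σ, hσ⟩ := dt_yo2 hdB (r1 ≫ y - r2 ≫ α) (by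
    rw [Preadditive.comp_sub, ← Category.assoc, hr1, ← Category.assoc, hr2, hy, sub_self])
  obtain ⟨m0, hm0⟩ := dt_yo3 hdB (σ ≫ β - c ≫ ω) (by
    rw [Preadditive.comp_sub, ← Category.assoc, ← hσ, Preadditive.sub_comp, Category.assoc,
      Category.assoc, hαβ, ← hy', ← Category.assoc, ← Category.assoc, ← hr1']
    simp)
  have hσβ : σ ≫ β = c ≫ ω + (c ≫ h) ≫ m0 := by rw [← hm0]; abel
  obtain ⟨k, hkdef⟩ : ∃ k, k = k' ≫ h := ⟨_, rfl⟩
  rw [← hkdef] at hk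
  have hkv : k ≫ v⟦(1 : ℤ)⟧' = κ := by
    rw [hkdef, Category.assoc, hv, ← Category.assoc, spl.kρ, Category.id_comp]
  have θiso := isIso_one_add hKS ar.indec₃ k m0 hk
  have θ'iso := isIso_one_add_swap k m0 θiso
  let s : E ⟶ E := biprod.inr ≫ σ
  have hsβ : s ≫ β = β ≫ (𝟙 U + k ≫ m0) := by
    change (biprod.inr ≫ σ) ≫ β = _
    rw [Category.assoc, hσβ, hcω, Preadditive.comp_add, hkdef]
    have : biprod.inr ≫ (c ≫ h) ≫ m0 = β ≫ (k' ≫ h) ≫ m0 := by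
      rw [← Category.assoc, ← Category.assoc, hcr]; simp
    rw [this]; simp
  have siso : IsIso s := by
    obtain ⟨t, ht⟩ := ar.right_almost_split (β ≫ inv (𝟙 U + k ≫ m0)) (by
      rintro ⟨s', hs'⟩
      apply ar.not_retraction
      refine ⟨inv (𝟙 U + k ≫ m0) ≫ s', ?_⟩
      have : s' ≫ β = 𝟙 U + k ≫ m0 := by
        rw [← Category.assoc] at hs'
        rw [(IsIso.comp_inv_eq _).1 hs', Category.id_comp]
      rw [Category.assoc, this, IsIso.inv_hom_id])
    apply isIso_of_two s t
    · apply ar_right_minimal hKS ar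
      rw [Category.assoc, ht, ← Category.assoc, hsβ, Category.assoc, IsIso.hom_inv_id,
        Category.comp_id]
    · apply ar_right_minimal hKS ar
      rw [Category.assoc, hsβ, ← Category.assoc, ht, Category.assoc, IsIso.inv_hom_id,
        Category.comp_id]
  have hσd : σ = biprod.fst ≫ biprod.inl ≫ σ + biprod.snd ≫ s := by
    ext <;> simp [s]
  obtain ⟨m, hm⟩ : ∃ m : Y ⊞ V ⟶ Z1 ⊞ E, m = biprod.lift (biprod.fst ≫ g ≫ p)
    (biprod.fst ≫ y - biprod.snd ≫ α) := ⟨_, rfl⟩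
  have hm1 : m ≫ biprod.fst = biprod.fst ≫ g ≫ p := by rw [hm]; simp
  have hm2 : m ≫ biprod.snd = biprod.fst ≫ y - biprod.snd ≫ α := by rw [hm]; simp
  obtain ⟨S, hS⟩ : ∃ S : Z1 ⊞ E ⟶ Z1 ⊞ E, S = biprod.lift biprod.fst σ := ⟨_, rfl⟩
  have hS1 : S ≫ biprod.fst = biprod.fst := by rw [hS]; simp
  have hS2 : S ≫ biprod.snd = σ := by rw [hS]; simp
  have hrm : biprod.lift r1 r2 ≫ m = π ≫ S := by
    ext
    · rw [Category.assoc, hm1, Category.assoc, hS1, biprod.lift_fst_assoc, ← Category.assoc,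
        ← hr1', Category.assoc, hcp]
    · rw [Category.assoc, hm2, Category.assoc, hS2, Preadditive.comp_sub, biprod.lift_fst_assoc,
        biprod.lift_snd_assoc, hσ]
  have hmc : m ≫ c = biprod.fst ≫ g := by
    rw [hc1, Preadditive.comp_add, ← Category.assoc m, hm1, ← Category.assoc m, hm2,
      Preadditive.sub_comp]
    have e1 : (biprod.snd ≫ α) ≫ β ≫ k' = (0 : Y ⊞ V ⟶ Z) := by
      rw [Category.assoc, reassoc_of% hαβ]; simp
    have e2 : (biprod.fst ≫ y) ≫ β ≫ k' = (biprod.fst : Y ⊞ V ⟶ Y) ≫ g ≫ ω ≫ k' := by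
      rw [Category.assoc, reassoc_of% hy']
    rw [e1, e2, sub_zero, Category.assoc, Category.assoc, ← Preadditive.comp_add,
      ← Preadditive.comp_add, add_comm, spl.tot, Category.comp_id]
  have hmD : m ≫ c ≫ h = 0 := by rw [← Category.assoc, hmc, Category.assoc, hgh, comp_zero]
  have hSc : S ≫ c = c + (c ≫ h) ≫ m0 ≫ k' := by
    conv_lhs => rw [hc1]
    rw [Preadditive.comp_add, ← Category.assoc, hS1, ← Category.assoc, hS2, ← Category.assoc, hσβ,
      Preadditive.add_comp, hcω, Category.assoc, Category.assoc _ m0]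
    conv_rhs => arg 1; rw [hc1]
    abel
  have hSD : S ≫ c ≫ h = (c ≫ h) ≫ (𝟙 _ + m0 ≫ k) := by
    rw [← Category.assoc, hSc, hkdef]; simp
  apply iso_of_bij (biprod.lift r1 r2)
  · intro Q w hw
    have hw1 : w ≫ r1 = 0 := by
      have := congrArg (· ≫ biprod.fst) hw
      simpa using this
    have hw2 : w ≫ r2 = 0 := by
      have := congrArg (· ≫ biprod.snd) hw
      simpa using this
    have hwS : (w ≫ π) ≫ S = 0 := by
      rw [Category.assoc, ← hrm, ← Category.assoc, hw, zero_comp]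
    have a1 : (w ≫ π) ≫ biprod.fst = 0 := by
      rw [← hS1, ← Category.assoc, hwS, zero_comp]
    have a2 : (w ≫ π) ≫ biprod.snd = 0 := by
      have : (w ≫ π) ≫ σ = 0 := by rw [← hS2, ← Category.assoc, hwS, zero_comp]
      rw [hσd, Preadditive.comp_add, ← Category.assoc, a1, zero_comp, zero_add,
        ← Category.assoc] at this
      rw [← cancel_mono s, this, zero_comp]
    have a3 : w ≫ π = 0 := by
      apply biprod.hom_ext
      · rw [a1, zero_comp]
      · rw [a2, zero_comp]
    obtain ⟨w', hw'⟩ := dt_co2 hdB w a3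
    have b1 : w' ≫ f = 0 := by rw [← hr1, ← Category.assoc, ← hw', hw1]
    have b2 : w' ≫ v = 0 := by rw [← hr2, ← Category.assoc, ← hw', hw2]
    obtain ⟨w'', hw''⟩ := dt_co1 hd (w'⟦(1 : ℤ)⟧') (by rw [← Functor.map_comp, b1, Functor.map_zero])
    obtain ⟨e, he⟩ := dt_co3 ar.distinguished (w'' ≫ ω) (by
      rw [Category.assoc, ← hv, ← Category.assoc, ← hw'', ← Functor.map_comp, b2,
        Functor.map_zero])
    have b3 : biprod.lift (w'' ≫ p) e ≫ c = w'' := by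
      rw [hc, biprod.lift_desc, ← Category.assoc e, ← he, Category.assoc, Category.assoc,
        ← Preadditive.comp_add, add_comm, spl.tot, Category.comp_id]
    apply shift_zero_of
    rw [hw', Functor.map_comp, hw'', ← b3, Category.assoc, Category.assoc]
    have := dt_comp31 hdB
    rw [Category.assoc] at this
    rw [this, comp_zero]
  · intro Q q
    obtain ⟨e, he⟩ : ∃ e : Q ⟶ Z1 ⊞ E, e = biprod.lift (q ≫ m ≫ biprod.fst)
      ((q ≫ m ≫ biprod.snd - q ≫ m ≫ biprod.fst ≫ biprod.inl ≫ σ) ≫ inv s) := ⟨_, rfl⟩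
    have heS : e ≫ S = q ≫ m := by
      ext
      · rw [Category.assoc, hS1, he]; simp
      · rw [Category.assoc, hS2, hσd, Preadditive.comp_add, he, biprod.lift_fst_assoc,
          biprod.lift_snd_assoc, Category.assoc _ (inv s), IsIso.inv_hom_id]
        simp
    obtain ⟨w, hw⟩ := dt_co3 hdB e (by
      rw [← cancel_mono (𝟙 _ + m0 ≫ k), Category.assoc, ← hSD, ← Category.assoc, heS,
        Category.assoc, hmD, comp_zero, zero_comp])
    obtain ⟨q', hq'⟩ : ∃ q', q' = q - w ≫ biprod.lift r1 r2 := ⟨_, rfl⟩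
    have hq'm : q' ≫ m = 0 := by
      rw [hq', Preadditive.sub_comp, Category.assoc, hrm, ← Category.assoc, ← hw, heS, sub_self]
    obtain ⟨w', hw'⟩ := dt_co2 hd (q' ≫ biprod.fst) (by
      rw [Category.assoc, ← hmc, ← Category.assoc, hq'm, zero_comp])
    have c1 : (q' ≫ biprod.fst) ≫ y - (q' ≫ biprod.snd) ≫ α = 0 := by
      rw [Category.assoc, Category.assoc, ← Preadditive.comp_sub, ← hm2, ← Category.assoc, hq'm,
        zero_comp]
    have c2 : (q' ≫ biprod.snd - w' ≫ v) ≫ α = 0 := by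
      rw [hw', Category.assoc, hy, ← Category.assoc, ← Preadditive.sub_comp] at c1
      rw [← neg_sub, Preadditive.neg_comp, c1, neg_zero]
    obtain ⟨a, ha⟩ := dt_co1 ar.distinguished ((q' ≫ biprod.snd - w' ≫ v)⟦(1 : ℤ)⟧') (by
      rw [← Functor.map_comp, c2, Functor.map_zero])
    obtain ⟨w2, hw2⟩ := (shiftFunctor C (1 : ℤ)).map_surjective (a ≫ k)
    have d1 : w2 ≫ f = 0 := by
      apply shift_zero_of
      rw [Functor.map_comp, hw2, hkdef, Category.assoc, Category.assoc, hhf, comp_zero, comp_zero]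
    have d2 : w2 ≫ v = q' ≫ biprod.snd - w' ≫ v := by
      apply (shiftFunctor C (1 : ℤ)).map_injective
      rw [Functor.map_comp, hw2, Category.assoc, hkv, ha]
    refine ⟨w + (w' + w2) ≫ fB, ?_⟩
    ext
    · rw [Category.assoc, biprod.lift_fst, Preadditive.add_comp, Category.assoc, hr1,
        Preadditive.add_comp, d1, ← hw', hq']
      simp
    · rw [Category.assoc, biprod.lift_snd, Preadditive.add_comp, Category.assoc, hr2,
        Preadditive.add_comp, d2, hq']
      simp

end LemA

set_option linter.unusedSectionVars false
section LemB

variable {C : Type u} [Category.{v} C] [Preadditive C] [HasZeroObject C] [HasShift C ℤ]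
  [∀ n : ℤ, (shiftFunctor C n).Additive] [Pretriangulated C] [HasFiniteBiproducts C]

lemma lemB3 {X Y Z U Z3 P Y3 : C} {f : X ⟶ Y} {g : Y ⟶ Z}
    {h : Z ⟶ X⟦(1 : ℤ)⟧} (hd : Triangle.mk f g h ∈ distTriang C)
    {ρ : X⟦(1 : ℤ)⟧ ⟶ U} {k' : U ⟶ Z} {i : Z3 ⟶ Z} {p : Z ⟶ Z3} (spl : Spl k' (h ≫ ρ) i p)
    (e : P⟦(1 : ℤ)⟧ ≅ U) {ρt : X ⟶ P} {kt : P ⟶ X} (hρ : ρt⟦(1 : ℤ)⟧' ≫ e.hom = ρ)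
    (hk : kt⟦(1 : ℤ)⟧' = e.hom ≫ k' ≫ h) (hkρ : kt ≫ ρt = 𝟙 P)
    (f3 : X ⟶ Y3) (π : Y3 ⟶ Z3) (hd3 : Triangle.mk f3 π (i ≫ h) ∈ distTriang C) :
    Nonempty (Y3 ≅ Y ⊞ P) := by
  have hgh := dt_comp23 hd
  have hhf := dt_comp31 hd
  have hρ' : ρt⟦(1 : ℤ)⟧' = ρ ≫ e.inv := by rw [← hρ]; simp
  have hih : i ≫ h ≫ ρ = 0 := spl.iρ
  obtain ⟨r1, hr1, hr1'⟩ := dt_mor2 hd3 hd (𝟙 X) i (by simp)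
  rw [Category.id_comp] at hr1
  obtain ⟨r2, hr2⟩ := dt_ext hd3 ρt (by
    rw [hρ', Category.assoc, ← Category.assoc h, ← Category.assoc i, hih, zero_comp])
  have hktf : kt ≫ f = 0 := by
    apply shift_zero_of
    rw [Functor.map_comp, hk, Category.assoc, Category.assoc, hhf, comp_zero, comp_zero]
  apply iso_of_bij (biprod.lift r1 r2)
  · intro Q w hw
    have hw1 : w ≫ r1 = 0 := by
      have := congrArg (· ≫ biprod.fst) hw
      simpa using this
    have hw2 : w ≫ r2 = 0 := by
      have := congrArg (· ≫ biprod.snd) hw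
      simpa using this
    have a1 : w ≫ π = 0 := by
      calc w ≫ π = w ≫ (π ≫ i) ≫ p := by rw [Category.assoc, spl.ip, Category.comp_id]
        _ = (w ≫ r1) ≫ g ≫ p := by rw [hr1']; simp
        _ = 0 := by rw [hw1, zero_comp]
    obtain ⟨w', hw'⟩ := dt_co2 hd3 w a1
    have b1 : w' ≫ f = 0 := by rw [← hr1, ← Category.assoc, ← hw', hw1]
    have b2 : w' ≫ ρt = 0 := by rw [← hr2, ← Category.assoc, ← hw', hw2]
    obtain ⟨w'', hw''⟩ := dt_co1 hd (w'⟦(1 : ℤ)⟧') (by rw [← Functor.map_comp, b1, Functor.map_zero])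
    have b3 : w'' ≫ h ≫ ρ = 0 := by
      rw [← Category.assoc, ← hw'', ← hρ, ← Category.assoc, ← Functor.map_comp, b2,
        Functor.map_zero, zero_comp]
    have b4 : w'' = (w'' ≫ p) ≫ i := by
      calc w'' = w'' ≫ ((h ≫ ρ) ≫ k' + p ≫ i) := by rw [spl.tot, Category.comp_id]
        _ = (w'' ≫ h ≫ ρ) ≫ k' + (w'' ≫ p) ≫ i := by simp [Preadditive.comp_add]
        _ = _ := by rw [b3, zero_comp, zero_add]
    apply shift_zero_of
    have := dt_comp31 hd3
    rw [hw', Functor.map_comp, hw'', b4, Category.assoc, Category.assoc]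
    rw [Category.assoc] at this
    rw [this, comp_zero]
  · intro Q q
    obtain ⟨y, hy⟩ : ∃ y, y = q ≫ biprod.fst := ⟨_, rfl⟩
    have e1 : y ≫ g = (y ≫ g ≫ p) ≫ i := by
      calc y ≫ g = (y ≫ g) ≫ ((h ≫ ρ) ≫ k' + p ≫ i) := by rw [spl.tot, Category.comp_id]
        _ = y ≫ (g ≫ h) ≫ ρ ≫ k' + (y ≫ g ≫ p) ≫ i := by simp [Preadditive.comp_add]
        _ = _ := by rw [hgh]; simp
    obtain ⟨w, hw⟩ := dt_co3 hd3 (y ≫ g ≫ p) (by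
      rw [← Category.assoc, ← e1, Category.assoc, hgh, comp_zero])
    obtain ⟨w', hw'⟩ := dt_co2 hd (y - w ≫ r1) (by
      rw [Preadditive.sub_comp, Category.assoc, ← hr1', ← Category.assoc w, ← hw, ← e1, sub_self])
    obtain ⟨x, hx⟩ : ∃ x, x = q ≫ biprod.snd - w ≫ r2 - w' ≫ ρt := ⟨_, rfl⟩
    refine ⟨w + (w' + x ≫ kt) ≫ f3, ?_⟩
    ext
    · rw [Category.assoc, biprod.lift_fst, Preadditive.add_comp, Category.assoc, hr1,
        Preadditive.add_comp, Category.assoc, hktf, ← hw', hy]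
      simp
    · rw [Category.assoc, biprod.lift_snd, Preadditive.add_comp, Category.assoc, hr2,
        Preadditive.add_comp, Category.assoc, hkρ, hx]
      simp

lemma lemB4 {X V E U P X2 Y4 : C} {α : V ⟶ E} {β : E ⟶ U} {κ : U ⟶ V⟦(1 : ℤ)⟧}
    (hdA : Triangle.mk α β κ ∈ distTriang C) {k : U ⟶ X⟦(1 : ℤ)⟧}
    {ρ : X⟦(1 : ℤ)⟧ ⟶ U} (hkρ : k ≫ ρ = 𝟙 U) (e : P⟦(1 : ℤ)⟧ ≅ U) {ρt : X ⟶ P} {kt : P ⟶ X}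
    {i2 : X2 ⟶ X} {pr : X ⟶ X2} (spl : Spl kt ρt i2 pr)
    (hρ : ρt⟦(1 : ℤ)⟧' ≫ e.hom = ρ)
    (hk : kt⟦(1 : ℤ)⟧' = e.hom ≫ k) {κt : P ⟶ V} (hκ : κt⟦(1 : ℤ)⟧' = e.hom ≫ κ)
    (f4 : X ⟶ Y4) (π : Y4 ⟶ E) (hd4 : Triangle.mk f4 π (β ≫ k) ∈ distTriang C) :
    Nonempty (Y4 ≅ V ⊞ X2) := by
  have hρ' : ρt⟦(1 : ℤ)⟧' = ρ ≫ e.inv := by rw [← hρ]; simp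
  have hk' : k = e.inv ≫ kt⟦(1 : ℤ)⟧' := by rw [hk]; simp
  have hβκ := dt_comp23 hdA
  have hαβ := dt_comp12 hdA
  have hrot : Triangle.mk (-κt) α (β ≫ e.inv) ∈ distTriang C := by
    rw [rotate_distinguished_triangle]
    change Triangle.mk α (β ≫ e.inv) (-((-κt)⟦(1 : ℤ)⟧')) ∈ distTriang C
    rw [Functor.map_neg, neg_neg, hκ]
    refine isomorphic_distinguished _ hdA _ ?_
    refine Triangle.isoMk _ _ (Iso.refl V) (Iso.refl E) e ?_ ?_ ?_
    · change α ≫ 𝟙 E = 𝟙 V ≫ α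
      simp
    · change (β ≫ e.inv) ≫ e.hom = 𝟙 E ≫ β
      simp
    · change (e.hom ≫ κ) ≫ (𝟙 V)⟦(1 : ℤ)⟧' = e.hom ≫ κ
      simp
  obtain ⟨r1, hr1, hr1'⟩ := dt_mor2 hd4 hrot ρt (𝟙 E) (by
    rw [hρ', Category.assoc, ← Category.assoc k, hkρ]; simp)
  rw [Category.comp_id] at hr1'
  obtain ⟨r2, hr2⟩ := dt_ext hd4 pr (by
    rw [hk', Category.assoc, Category.assoc, ← Functor.map_comp, spl.kp, Functor.map_zero,
      comp_zero, comp_zero])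
  apply iso_of_bij (biprod.lift r1 r2)
  · intro Q w hw
    have hw1 : w ≫ r1 = 0 := by
      have := congrArg (· ≫ biprod.fst) hw
      simpa using this
    have hw2 : w ≫ r2 = 0 := by
      have := congrArg (· ≫ biprod.snd) hw
      simpa using this
    have a1 : w ≫ π = 0 := by rw [hr1', ← Category.assoc, hw1, zero_comp]
    obtain ⟨w', hw'⟩ := dt_co2 hd4 w a1
    have b1 : (w' ≫ ρt) ≫ κt = 0 := by
      have : w' ≫ ρt ≫ (-κt) = 0 := by rw [← hr1, ← Category.assoc, ← hw', hw1]
      simpa using this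
    have b2 : w' ≫ pr = 0 := by rw [← hr2, ← Category.assoc, ← hw', hw2]
    obtain ⟨x, hx⟩ := dt_co3 hdA ((w' ≫ ρt)⟦(1 : ℤ)⟧' ≫ e.hom) (by
      rw [Category.assoc, ← hκ, ← Functor.map_comp, b1, Functor.map_zero])
    have b3 : w' = (w' ≫ ρt) ≫ kt := by
      calc w' = w' ≫ (ρt ≫ kt + pr ≫ i2) := by rw [spl.tot, Category.comp_id]
        _ = (w' ≫ ρt) ≫ kt + (w' ≫ pr) ≫ i2 := by simp [Preadditive.comp_add]
        _ = _ := by rw [b2, zero_comp, add_zero]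
    have b4 : w'⟦(1 : ℤ)⟧' = x ≫ β ≫ k := by
      rw [b3, Functor.map_comp, hk, ← Category.assoc, hx, Category.assoc]
    apply shift_zero_of
    rw [hw', Functor.map_comp, b4, Category.assoc, dt_comp31 hd4, comp_zero]
  · intro Q q
    obtain ⟨w, hw⟩ := dt_co3 hd4 ((q ≫ biprod.fst) ≫ α) (by
      rw [Category.assoc, ← Category.assoc α, hαβ, zero_comp, comp_zero])
    obtain ⟨x, hx⟩ := dt_co1 hdA ((q ≫ biprod.fst - w ≫ r1)⟦(1 : ℤ)⟧') (by
      rw [← Functor.map_comp, Preadditive.sub_comp, Category.assoc w, ← hr1', ← hw, sub_self,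
        Functor.map_zero])
    obtain ⟨x', hx'⟩ := (shiftFunctor C (1 : ℤ)).map_surjective (x ≫ e.inv)
    have h1 : x' ≫ κt = q ≫ biprod.fst - w ≫ r1 := by
      apply (shiftFunctor C (1 : ℤ)).map_injective
      rw [Functor.map_comp, hx', hκ, hx]; simp
    refine ⟨w + (-(x' ≫ kt) + (q ≫ biprod.snd - w ≫ r2) ≫ i2) ≫ f4, ?_⟩
    ext
    · rw [Category.assoc, biprod.lift_fst, Preadditive.add_comp, Category.assoc, hr1,
        ← Category.assoc _ ρt, Preadditive.add_comp, Preadditive.neg_comp, Category.assoc,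
        Category.assoc, spl.kρ, spl.iρ, comp_zero, add_zero, Category.comp_id]
      rw [Preadditive.comp_neg, Preadditive.neg_comp, neg_neg, h1]
      abel
    · rw [Category.assoc, biprod.lift_snd, Preadditive.add_comp, Category.assoc, hr2,
        Preadditive.add_comp, Preadditive.neg_comp, Category.assoc,
        Category.assoc, spl.kp, spl.ip]
      simp

end LemB

set_option linter.unusedSectionVars false
section Cls

variable {C : Type u} [Category.{v} C] [Preadditive C] [HasFiniteBiproducts C]

lemma cls_biprod (A B : C) : clsZero C (A ⊞ B) = clsZero C A + clsZero C B := by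
  have : (QuotientAddGroup.mk (FreeAbelianGroup.of A + FreeAbelianGroup.of B
      - FreeAbelianGroup.of (A ⊞ B)) : K0Zero C) = 0 := by
    rw [QuotientAddGroup.eq_zero_iff]
    exact AddSubgroup.subset_closure (Or.inl ⟨A, B, rfl⟩)
  rw [QuotientAddGroup.mk_sub, QuotientAddGroup.mk_add] at this
  exact (sub_eq_zero.1 this).symm

lemma cls_iso {A B : C} (h : Nonempty (A ≅ B)) : clsZero C A = clsZero C B := by
  have : (QuotientAddGroup.mk (FreeAbelianGroup.of A - FreeAbelianGroup.of B) : K0Zero C) = 0 := by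
    rw [QuotientAddGroup.eq_zero_iff]
    exact AddSubgroup.subset_closure (Or.inr ⟨A, B, h, rfl⟩)
  rw [QuotientAddGroup.mk_sub] at this
  exact sub_eq_zero.1 this

lemma cls_iso_biprod {A B D : C} (h : Nonempty (A ≅ B ⊞ D)) :
    clsZero C A = clsZero C B + clsZero C D := by
  rw [cls_iso h, cls_biprod]

end Cls

section Main

variable {C : Type u} [Category.{v} C] [Preadditive C] [HasZeroObject C] [HasShift C ℤ]
  [∀ n : ℤ, (shiftFunctor C n).Additive] [Pretriangulated C] [HasFiniteBiproducts C]

variable (K : Type w) [Field K] [Linear K C]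

/-- The subspace of morphisms out of `X` factoring through `f`. -/
def Rsub {X Y : C} (f : X ⟶ Y) (V : C) : Submodule K (X ⟶ V) :=
  LinearMap.range (Linear.leftComp K V f)

lemma mem_Rsub {X Y V : C} (f : X ⟶ Y) (r : X ⟶ V) : r ∈ Rsub K f V ↔ ∃ b, f ≫ b = r :=
  Iff.rfl

variable (homFin : ∀ X Y : C, FiniteDimensional K (X ⟶ Y))

/-- Finite support list. -/
def SuppList (X : C) {N : ℕ} (ind : Fin N → C) : Prop :=
  ∀ B : C, Indec B → (∃ φ : X ⟶ B, φ ≠ 0) → ∃ i, Nonempty (B ≅ ind i)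

lemma growth (homFin : ∀ X Y : C, FiniteDimensional K (X ⟶ Y))
    {X : C} {N : ℕ} {ind : Fin N → C} (hs : SuppList X ind)
    {Y Z Y' Z' V : C} {f : X ⟶ Y} {g : Y ⟶ Z} {h : Z ⟶ X⟦(1 : ℤ)⟧}
    (hd : Triangle.mk f g h ∈ distTriang C) {f' : X ⟶ Y'} {g' : Y' ⟶ Z'} {c : Z' ⟶ Z}
    (hd' : Triangle.mk f' g' (c ≫ h) ∈ distTriang C) (hV : Indec V) (r : X ⟶ V)
    (h1 : h ≫ r⟦(1 : ℤ)⟧' ≠ 0) (h2 : (c ≫ h) ≫ r⟦(1 : ℤ)⟧' = 0) :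
    ∑ i, Module.finrank K (Rsub K f (ind i)) < ∑ i, Module.finrank K (Rsub K f' (ind i)) := by
  have hle : ∀ W : C, Rsub K f W ≤ Rsub K f' W := by
    intro W a ha
    rw [mem_Rsub, ← dt_ext_iff hd] at ha
    rw [mem_Rsub, ← dt_ext_iff hd', Category.assoc, ha, comp_zero]
  obtain ⟨i0, ⟨φ⟩⟩ := hs V hV ⟨r, by rintro rfl; apply h1; simp⟩
  apply Finset.sum_lt_sum
  · intro i _
    have := homFin X (ind i)
    exact Submodule.finrank_mono (hle _)
  · refine ⟨i0, Finset.mem_univ _, ?_⟩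
    have := homFin X (ind i0)
    apply Submodule.finrank_lt_finrank_of_lt
    refine lt_of_le_of_ne (hle _) ?_
    intro heq
    have m1 : r ≫ φ.hom ∈ Rsub K f' (ind i0) := by
      rw [mem_Rsub, ← dt_ext_iff hd', Functor.map_comp, ← Category.assoc, h2, zero_comp]
    rw [← heq, mem_Rsub, ← dt_ext_iff hd, Functor.map_comp, ← Category.assoc] at m1
    apply h1
    rw [← cancel_mono (φ.hom⟦(1 : ℤ)⟧'), m1, zero_comp]

lemma find_v (homFin : ∀ X Y : C, FiniteDimensional K (X ⟶ Y))
    (hKS : IsKrullSchmidt C) {X : C} {N : ℕ} {ind : Fin N → C} (hs : SuppList X ind)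
    {Y Z : C} {f : X ⟶ Y} {g : Y ⟶ Z} {h : Z ⟶ X⟦(1 : ℤ)⟧}
    (hd : Triangle.mk f g h ∈ distTriang C) (n : ℕ) :
    ∀ (V : C) (v : X ⟶ V), Indec V → h ≫ v⟦(1 : ℤ)⟧' ≠ 0 →
      ∑ i, Module.finrank K (Rsub K v (ind i) ⊔ Rsub K f (ind i) : Submodule K (X ⟶ ind i)) ≤ n →
      ∃ (V : C) (v : X ⟶ V), Indec V ∧ h ≫ v⟦(1 : ℤ)⟧' ≠ 0 ∧
        ∀ (E : C) (α : V ⟶ E), (¬ ∃ r : E ⟶ V, α ≫ r = 𝟙 V) → h ≫ (v ≫ α)⟦(1 : ℤ)⟧' = 0 := by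
  have key : ∀ (V : C) (v : X ⟶ V), Indec V → h ≫ v⟦(1 : ℤ)⟧' ≠ 0 →
      (¬ ∀ (E : C) (α : V ⟶ E), (¬ ∃ r : E ⟶ V, α ≫ r = 𝟙 V) → h ≫ (v ≫ α)⟦(1 : ℤ)⟧' = 0) →
      ∃ (V' : C) (v' : X ⟶ V'), Indec V' ∧ h ≫ v'⟦(1 : ℤ)⟧' ≠ 0 ∧
      ∑ i, Module.finrank K (Rsub K v' (ind i) ⊔ Rsub K f (ind i) : Submodule K (X ⟶ ind i)) <
      ∑ i, Module.finrank K (Rsub K v (ind i) ⊔ Rsub K f (ind i) : Submodule K (X ⟶ ind i)) := by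
    intro V v hV hv hn
    push Not at hn
    obtain ⟨E, α, hα, hne⟩ := hn
    obtain ⟨m, W, ι, π, hW, -, htot⟩ := ks_decomp hKS E
    obtain ⟨j, hj⟩ : ∃ j, h ≫ (v ≫ α ≫ π j)⟦(1 : ℤ)⟧' ≠ 0 := by
      by_contra hcon
      push Not at hcon
      apply hne
      calc h ≫ (v ≫ α)⟦(1 : ℤ)⟧' = h ≫ (v ≫ α ≫ ∑ j, π j ≫ ι j)⟦(1 : ℤ)⟧' := by
            rw [htot, Category.comp_id]
        _ = ∑ j, (h ≫ (v ≫ α ≫ π j)⟦(1 : ℤ)⟧') ≫ (ι j)⟦(1 : ℤ)⟧' := by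
            simp only [Preadditive.comp_sum, Functor.map_sum, Functor.map_comp, Category.assoc]
        _ = 0 := by simp only [hcon, zero_comp, Finset.sum_const_zero]
    refine ⟨W j, v ≫ α ≫ π j, hW j, hj, ?_⟩
    have hle : ∀ D : C, Rsub K (v ≫ α ≫ π j) D ⊔ Rsub K f D ≤ Rsub K v D ⊔ Rsub K f D := by
      intro D
      refine sup_le_sup_right ?_ _
      rintro a ⟨b, hb⟩
      refine ⟨(α ≫ π j) ≫ b, ?_⟩
      rw [← hb]
      simp
    obtain ⟨i0, ⟨φ⟩⟩ := hs V hV ⟨v, by rintro rfl; apply hv; simp⟩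
    apply Finset.sum_lt_sum
    · intro i _
      have := homFin X (ind i)
      exact Submodule.finrank_mono (hle _)
    · refine ⟨i0, Finset.mem_univ _, ?_⟩
      have := homFin X (ind i0)
      apply Submodule.finrank_lt_finrank_of_lt
      refine lt_of_le_of_ne (hle _) ?_
      intro heq
      have m1 : v ≫ φ.hom ∈ Rsub K v (ind i0) ⊔ Rsub K f (ind i0) :=
        Submodule.mem_sup_left ⟨φ.hom, rfl⟩
      rw [← heq, Submodule.mem_sup] at m1
      obtain ⟨a, ⟨r, hr⟩, b, ⟨s, hs⟩, hab⟩ := m1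
      change (v ≫ α ≫ π j) ≫ r = a at hr
      change f ≫ s = b at hs
      have hiso := isIso_one_add hKS hV α (-(π j ≫ r ≫ φ.inv))
        (by rintro ⟨r', hr'⟩; exact hα r' hr')
      have h3 : v ≫ (𝟙 V + α ≫ (-(π j ≫ r ≫ φ.inv))) = f ≫ s ≫ φ.inv := by
        have : f ≫ s = v ≫ φ.hom - (v ≫ α ≫ π j) ≫ r := by rw [hs, hr, ← hab]; abel
        rw [← Category.assoc f, this]
        simp [Preadditive.comp_add, sub_eq_add_neg]
      apply hv
      rw [dt_ext_iff hd]
      refine ⟨(s ≫ φ.inv) ≫ inv (𝟙 V + α ≫ (-(π j ≫ r ≫ φ.inv))), ?_⟩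
      rw [← Category.assoc, ← h3, Category.assoc, IsIso.hom_inv_id, Category.comp_id]
  induction n with
  | zero =>
    intro V v hV hv hle
    by_contra hcon
    obtain ⟨V', v', -, -, hlt⟩ := key V v hV hv (fun hall => hcon ⟨V, v, hV, hv, hall⟩)
    omega
  | succ n ih =>
    intro V v hV hv hle
    by_cases hall : ∀ (E : C) (α : V ⟶ E), (¬ ∃ r : E ⟶ V, α ≫ r = 𝟙 V) →
        h ≫ (v ≫ α)⟦(1 : ℤ)⟧' = 0
    · exact ⟨V, v, hV, hv, hall⟩
    · obtain ⟨V', v', hV', hv', hlt⟩ := key V v hV hv hall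
      exact ih V' v' hV' hv' (by omega)

/-- AR relations whose connecting map factors through `S[1]`. -/
def arRelS (C : Type u) [Category.{v} C] [Preadditive C] [HasZeroObject C] [HasShift C ℤ]
  [∀ n : ℤ, (shiftFunctor C n).Additive] [Pretriangulated C] [HasFiniteBiproducts C]
  (S : Set C) : Set (K0Zero C) :=
  {x | ∃ (X Y Z : C) (f : X ⟶ Y) (g : Y ⟶ Z) (h : Z ⟶ X⟦(1 : ℤ)⟧),
        IsARTriangle C f g h ∧ FactorsThruShift C S h ∧
        x = clsZero C X + clsZero C Z - clsZero C Y}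

lemma factors_pre {S : Set C} {X Z Z' : C} {h : Z ⟶ X⟦(1 : ℤ)⟧} (hf : FactorsThruShift C S h)
    (c : Z' ⟶ Z) : FactorsThruShift C S (c ≫ h) := by
  obtain ⟨t, ht, a, b, rfl⟩ := hf
  exact ⟨t, ht, c ≫ a, b, by simp⟩

lemma factors_post {S : Set C} {X X' Z : C} {h : Z ⟶ X⟦(1 : ℤ)⟧} (hf : FactorsThruShift C S h)
    (c : X⟦(1 : ℤ)⟧ ⟶ X'⟦(1 : ℤ)⟧) : FactorsThruShift C S (h ≫ c) := by
  obtain ⟨t, ht, a, b, rfl⟩ := hf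
  exact ⟨t, ht, a, b ≫ c, by simp⟩

theorem main_ind (homFin : ∀ X Y : C, FiniteDimensional K (X ⟶ Y))
    (hKS : IsKrullSchmidt C) (hAR : HasARTriangles C) (S : Set C)
    {X : C} {N : ℕ} {ind : Fin N → C} (hs : SuppList X ind) (n : ℕ) :
    ∀ {Y Z : C} {f : X ⟶ Y} {g : Y ⟶ Z} {h : Z ⟶ X⟦(1 : ℤ)⟧}
    (_ : Triangle.mk f g h ∈ distTriang C) (_ : FactorsThruShift C S h)
    (_ : ∑ i, Module.finrank K (X ⟶ ind i) ≤ ∑ i, Module.finrank K (Rsub K f (ind i)) + n),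
    clsZero C X + clsZero C Z - clsZero C Y ∈ AddSubgroup.closure (arRelS C S) := by
  induction n using Nat.strong_induction_on with
  | _ n ih =>
  intro Y Z f g h hd hS hn
  have ih' : ∀ {Y' Z' : C} {f' : X ⟶ Y'} {g' : Y' ⟶ Z'} {h' : Z' ⟶ X⟦(1 : ℤ)⟧}
      (_ : Triangle.mk f' g' h' ∈ distTriang C) (_ : FactorsThruShift C S h')
      (_ : ∑ i, Module.finrank K (Rsub K f (ind i)) < ∑ i, Module.finrank K (Rsub K f' (ind i))),
      clsZero C X + clsZero C Z' - clsZero C Y' ∈ AddSubgroup.closure (arRelS C S) := by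
    intro Y' Z' f' g' h' hd' hS' hlt
    have hb : ∑ i, Module.finrank K (Rsub K f' (ind i)) ≤ ∑ i, Module.finrank K (X ⟶ ind i) := by
      apply Finset.sum_le_sum
      intro i _
      have := homFin X (ind i)
      exact Submodule.finrank_le _
    exact ih (n - 1) (by omega) hd' hS' (by omega)
  by_cases h0 : h = 0
  · obtain ⟨e, -, -⟩ := exists_iso_binaryBiproduct_of_distTriang _ hd h0
    have : clsZero C Y = clsZero C X + clsZero C Z := cls_iso_biprod ⟨e⟩
    rw [this, sub_self]
    exact AddSubgroup.zero_mem _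
  -- find a morphism `v`
  obtain ⟨V, v, hV, hv, hvα⟩ : ∃ (V : C) (v : X ⟶ V), Indec V ∧ h ≫ v⟦(1 : ℤ)⟧' ≠ 0 ∧
      ∀ (E : C) (α : V ⟶ E), (¬ ∃ r : E ⟶ V, α ≫ r = 𝟙 V) → h ≫ (v ≫ α)⟦(1 : ℤ)⟧' = 0 := by
    obtain ⟨m, W, ι, π, hW, -, htot⟩ := ks_decomp hKS X
    obtain ⟨j, hj⟩ : ∃ j, h ≫ (π j)⟦(1 : ℤ)⟧' ≠ 0 := by
      by_contra hcon
      push Not at hcon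
      apply h0
      calc h = h ≫ (∑ j, π j ≫ ι j)⟦(1 : ℤ)⟧' := by
            rw [htot]; simp
        _ = ∑ j, (h ≫ (π j)⟦(1 : ℤ)⟧') ≫ (ι j)⟦(1 : ℤ)⟧' := by
            simp only [Preadditive.comp_sum, Functor.map_sum, Functor.map_comp, Category.assoc]
        _ = 0 := by simp only [hcon, zero_comp, Finset.sum_const_zero]
    exact find_v K homFin hKS hs hd _ (W j) (π j) (hW j) hj le_rfl
  obtain ⟨E, U, α, β, κ, ar⟩ := hAR V hV
  obtain ⟨ω, hω⟩ := dt_co1 ar.distinguished (h ≫ v⟦(1 : ℤ)⟧') (by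
    rw [Category.assoc, ← Functor.map_comp, hvα E α ar.not_section])
  obtain ⟨k', hk'⟩ : ∃ k' : U ⟶ Z, k' ≫ ω = 𝟙 U := by
    by_contra hcon
    exact hv (by rw [hω, ar_pre_zero ar ω hcon])
  have hβκ := dt_comp23 ar.distinguished
  have hκ : κ = k' ≫ h ≫ v⟦(1 : ℤ)⟧' := by
    rw [hω, ← Category.assoc, hk', Category.id_comp]
  have hκS : FactorsThruShift C S κ := by
    rw [hκ]; exact factors_pre (factors_post hS _) _
  have hrel : clsZero C V + clsZero C U - clsZero C E ∈ AddSubgroup.closure (arRelS C S) :=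
    AddSubgroup.subset_closure ⟨V, E, U, α, β, κ, ar, hκS, rfl⟩
  by_cases hk : ∃ ρ, (k' ≫ h) ≫ ρ = 𝟙 U
  · obtain ⟨ρ, hρ⟩ := hk
    obtain ⟨Z3, i, p, spl⟩ := exists_spl k' (h ≫ ρ) (by rw [← Category.assoc, hρ])
    have e : (U⟦(-1 : ℤ)⟧)⟦(1 : ℤ)⟧ ≅ U := shiftNegShift U 1
    obtain ⟨ρt, hρt⟩ := (shiftFunctor C (1 : ℤ)).map_surjective (ρ ≫ e.inv)
    obtain ⟨kt, hkt⟩ := (shiftFunctor C (1 : ℤ)).map_surjective (e.hom ≫ k' ≫ h)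
    obtain ⟨κt, hκt⟩ := (shiftFunctor C (1 : ℤ)).map_surjective (e.hom ≫ κ)
    have hρt' : ρt⟦(1 : ℤ)⟧' ≫ e.hom = ρ := by rw [hρt]; simp
    have hktρt : kt ≫ ρt = 𝟙 _ := by
      apply (shiftFunctor C (1 : ℤ)).map_injective
      rw [Functor.map_comp, hkt, hρt, Category.assoc, ← Category.assoc (k' ≫ h), hρ]
      simp
    obtain ⟨X2, i2, pr, spl2⟩ := exists_spl kt ρt hktρt
    obtain ⟨Y3, f3, π3, hd3⟩ := dt_ofconn (i ≫ h)
    obtain ⟨Y4, f4, π4, hd4⟩ := dt_ofconn ((β ≫ k') ≫ h)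
    have iso3 := lemB3 hd spl e hρt' hkt hktρt f3 π3 hd3
    have iso4 := lemB4 ar.distinguished hρ e spl2 hρt' hkt hκt f4 π4
      (by rw [← Category.assoc]; exact hd4)
    have hr0 : ∀ {Q : C} (a : Q ⟶ X⟦(1 : ℤ)⟧), a ≫ (ρt ≫ κt)⟦(1 : ℤ)⟧' = (a ≫ ρ) ≫ κ := by
      intro Q a
      rw [Functor.map_comp, hρt, hκt]; simp
    have hr1 : h ≫ (ρt ≫ κt)⟦(1 : ℤ)⟧' ≠ 0 := by
      intro hz
      apply ar_conn_ne ar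
      have : (k' ≫ h) ≫ (ρt ≫ κt)⟦(1 : ℤ)⟧' = 0 := by rw [Category.assoc, hz, comp_zero]
      rw [hr0, hρ, Category.id_comp] at this
      exact this
    have g3 := ih' hd3 (factors_pre hS i) (growth K homFin hs hd hd3 hV _ hr1 (by
      rw [hr0, Category.assoc i, spl.iρ, zero_comp]))
    have g4 := ih' hd4 (factors_pre hS (β ≫ k')) (growth K homFin hs hd hd4 hV _ hr1 (by
      rw [hr0, Category.assoc β, Category.assoc β, hρ, Category.comp_id, hβκ]))
    have eZ := cls_iso_biprod spl.iso
    have eX := cls_iso_biprod spl2.iso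
    have e3 := cls_iso_biprod iso3
    have e4 := cls_iso_biprod iso4
    have := AddSubgroup.add_mem _ (AddSubgroup.add_mem _ g3 g4) hrel
    convert this using 1
    rw [eZ, e3, e4]
    have : clsZero C X2 = clsZero C X - clsZero C (U⟦(-1 : ℤ)⟧) := by rw [eX]; abel
    rw [this]
    abel
  · obtain ⟨Z1, i, p, spl⟩ := exists_spl k' ω hk'
    obtain ⟨B, fB, π, hdB⟩ := dt_ofconn (biprod.desc i (β ≫ k') ≫ h)
    have isoB := lemA hKS hd ar v spl hω hk fB π hdB
    have hcω : biprod.desc i (β ≫ k') ≫ ω = biprod.snd ≫ β := by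
      ext
      · simp [spl.iρ]
      · simp [spl.kρ]
    have g1 := ih' hdB (factors_pre hS _) (growth K homFin hs hd hdB hV v hv (by
      rw [Category.assoc, hω, ← Category.assoc, hcω, Category.assoc, hβκ, comp_zero]))
    have eZ := cls_iso_biprod spl.iso
    have eB := cls_iso_biprod isoB
    have := AddSubgroup.add_mem _ g1 hrel
    convert this using 1
    rw [eZ, eB, cls_biprod]
    abel

lemma exists_suppList (hKS : IsKrullSchmidt C) (hL : LocFinite C) (X : C) :
    ∃ (N : ℕ) (ind : Fin N → C), SuppList X ind := by
  obtain ⟨m, W, ι, π, hW, -, htot⟩ := ks_decomp hKS X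
  choose n ind hind using fun j => (hL (W j) (hW j)).1
  let e := Fintype.equivFin (Σ j, Fin (n j))
  refine ⟨_, fun a => ind (e.symm a).1 (e.symm a).2, ?_⟩
  rintro B hB ⟨φ, hφ⟩
  obtain ⟨j, hj⟩ : ∃ j, ι j ≫ φ ≠ 0 := by
    by_contra hcon
    push Not at hcon
    apply hφ
    calc φ = (∑ j, π j ≫ ι j) ≫ φ := by rw [htot, Category.id_comp]
      _ = 0 := by simp only [Preadditive.sum_comp, Category.assoc, hcon, comp_zero,
                    Finset.sum_const_zero]
  obtain ⟨i, hi⟩ := hind j B hB ⟨_, hj⟩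
  refine ⟨e ⟨j, i⟩, ?_⟩
  change Nonempty (B ≅ (fun a : (Σ j, Fin (n j)) => ind a.1 a.2) (e.symm (e ⟨j, i⟩)))
  rw [e.symm_apply_apply]
  exact hi

theorem main_forward (homFin : ∀ X Y : C, FiniteDimensional K (X ⟶ Y))
    (hKS : IsKrullSchmidt C) (hAR : HasARTriangles C) (hL : LocFinite C)
    (S : Set C) : relTriRel C S ⊆ AddSubgroup.closure (arRelS C S) := by
  rintro x ⟨Tr, hTr, hS, rfl⟩
  obtain ⟨N, ind, hs⟩ := exists_suppList hKS hL Tr.obj₁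
  exact main_ind K homFin hKS hAR S hs _ (f := Tr.mor₁) (g := Tr.mor₂) (h := Tr.mor₃) hTr hS
    (Nat.le_add_left _ _)

end Main

set_option linter.unusedSectionVars false
section Conv1

variable {C : Type u} [Category.{v} C] [Preadditive C] [HasFiniteBiproducts C]

/-- Extend an additive function on objects to `K₀(C, 0)`. -/
def k0lift (φ : C → ℤ) (hadd : ∀ A B : C, φ (A ⊞ B) = φ A + φ B)
    (hiso : ∀ A B : C, Nonempty (A ≅ B) → φ A = φ B) : K0Zero C →+ ℤ :=
  QuotientAddGroup.lift _ (FreeAbelianGroup.lift φ) (by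
    rw [AddSubgroup.closure_le]
    rintro x (⟨A, B, rfl⟩ | ⟨A, B, h, rfl⟩)
    · simp [hadd]
    · simp [hiso A B h])

lemma k0lift_cls (φ : C → ℤ) (hadd : ∀ A B : C, φ (A ⊞ B) = φ A + φ B)
    (hiso : ∀ A B : C, Nonempty (A ≅ B) → φ A = φ B) (A : C) :
    k0lift φ hadd hiso (clsZero C A) = φ A := by
  simp [k0lift, clsZero]

variable (K : Type w) [Field K] [Linear K C]

/-- Linear equivalence for maps into a biproduct. -/
def homIntoBiprod (B A A' : C) : (B ⟶ A ⊞ A') ≃ₗ[K] (B ⟶ A) × (B ⟶ A') where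
  toFun a := (a ≫ biprod.fst, a ≫ biprod.snd)
  invFun p := biprod.lift p.1 p.2
  map_add' a b := by simp
  map_smul' c a := by simp
  left_inv a := by ext <;> simp
  right_inv p := by simp

/-- Linear equivalence for maps out of a biproduct. -/
def homFromBiprod (B A A' : C) : (A ⊞ A' ⟶ B) ≃ₗ[K] (A ⟶ B) × (A' ⟶ B) where
  toFun a := (biprod.inl ≫ a, biprod.inr ≫ a)
  invFun p := biprod.desc p.1 p.2
  map_add' a b := by simp
  map_smul' c a := by simp
  left_inv a := by ext <;> simp
  right_inv p := by simp

variable (homFin : ∀ X Y : C, FiniteDimensional K (X ⟶ Y))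

/-- `A ↦ dim Hom(B, A)` on `K₀(C, 0)`. -/
def dimFrom (B : C) : K0Zero C →+ ℤ :=
  k0lift (fun A => (Module.finrank K (B ⟶ A) : ℤ))
    (fun A A' => by
      have := homFin B A
      have := homFin B A'
      rw [(homIntoBiprod K B A A').finrank_eq, Module.finrank_prod]; simp)
    (fun A A' ⟨e⟩ => by rw [(Linear.homCongr K (Iso.refl B) e).finrank_eq])

/-- `A ↦ dim Hom(A, B)` on `K₀(C, 0)`. -/
def dimTo (B : C) : K0Zero C →+ ℤ :=
  k0lift (fun A => (Module.finrank K (A ⟶ B) : ℤ))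
    (fun A A' => by
      have := homFin A B
      have := homFin A' B
      rw [(homFromBiprod K B A A').finrank_eq, Module.finrank_prod]; simp)
    (fun A A' ⟨e⟩ => by rw [(Linear.homCongr K e (Iso.refl B)).finrank_eq])

lemma dimFrom_cls (B A : C) :
    dimFrom K homFin B (clsZero C A) = (Module.finrank K (B ⟶ A) : ℤ) := k0lift_cls _ _ _ _

lemma dimTo_cls (B A : C) :
    dimTo K homFin B (clsZero C A) = (Module.finrank K (A ⟶ B) : ℤ) := k0lift_cls _ _ _ _

end Conv1

lemma finrank_short_exact {K : Type w} [Field K] {M N P : Type v} [AddCommGroup M]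
    [AddCommGroup N] [AddCommGroup P] [Module K M] [Module K N] [Module K P]
    [FiniteDimensional K N] (F : M →ₗ[K] N) (G : N →ₗ[K] P) (hF : Function.Injective F)
    (hG : Function.Surjective G) (hFG : LinearMap.range F = LinearMap.ker G) :
    Module.finrank K N = Module.finrank K M + Module.finrank K P := by
  rw [← LinearMap.finrank_range_add_finrank_ker G, ← hFG, LinearMap.finrank_range_of_inj hF,
    LinearMap.range_eq_top.2 hG, finrank_top, add_comm]

section Conv2

variable {C : Type u} [Category.{v} C] [Preadditive C] [HasZeroObject C] [HasShift C ℤ]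
  [∀ n : ℤ, (shiftFunctor C n).Additive] [Pretriangulated C] [HasFiniteBiproducts C]

variable (K : Type w) [Field K] [Linear K C]
variable (homFin : ∀ X Y : C, FiniteDimensional K (X ⟶ Y))

lemma shift_ne_zero {Z : C} (hZ : ¬ IsZero Z) (n : ℤ) : ¬ IsZero (Z⟦n⟧) := by
  intro h
  apply hZ
  rw [IsZero.iff_id_eq_zero] at h ⊢
  apply (shiftFunctor C n).map_injective
  rw [CategoryTheory.Functor.map_id, h, Functor.map_zero]

lemma ar_dimFrom {X Y Z B : C} {f : X ⟶ Y} {g : Y ⟶ Z} {h : Z ⟶ X⟦(1 : ℤ)⟧}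
    (ar : IsARTriangle C f g h) (hB : Indec B) (h1 : ¬ Nonempty (B ≅ Z))
    (h2 : ¬ Nonempty (B ≅ Z⟦(-1 : ℤ)⟧)) :
    dimFrom K homFin B (clsZero C X + clsZero C Z - clsZero C Y) = 0 := by
  have hd := ar.distinguished
  have := homFin B Y
  rw [map_sub, map_add, dimFrom_cls, dimFrom_cls, dimFrom_cls,
    finrank_short_exact (Linear.rightComp K B f) (Linear.rightComp K B g) ?_ ?_ ?_]
  · simp
  · rw [injective_iff_map_eq_zero]
    intro a ha
    change a ≫ f = 0 at ha
    obtain ⟨b, hb⟩ := dt_co1 hd (a⟦(1 : ℤ)⟧') (by rw [← Functor.map_comp, ha, Functor.map_zero])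
    apply shift_zero_of
    rw [hb]
    apply ar_pre_zero ar
    rintro ⟨s, hs⟩
    apply h2
    have e : (Z⟦(-1 : ℤ)⟧)⟦(1 : ℤ)⟧ ≅ Z := shiftNegShift Z 1
    obtain ⟨s', hs'⟩ := (shiftFunctor C (1 : ℤ)).map_surjective (e.hom ≫ s)
    obtain ⟨b', hb'⟩ := (shiftFunctor C (1 : ℤ)).map_surjective (b ≫ e.inv)
    refine indec_iso_of_split hB (shift_ne_zero ar.indec₃.1 _) s' b' ?_
    apply (shiftFunctor C (1 : ℤ)).map_injective
    rw [Functor.map_comp, hs', hb', Category.assoc, ← Category.assoc s, hs]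
    simp
  · intro b
    exact ar.right_almost_split b (fun ⟨s, hs⟩ =>
      h1 (indec_iso_of_split hB ar.indec₃.1 s b hs))
  · ext a
    constructor
    · rintro ⟨b, rfl⟩
      change (b ≫ f) ≫ g = 0
      rw [Category.assoc, dt_comp12 hd, comp_zero]
    · intro ha
      obtain ⟨b, hb⟩ := dt_co2 hd a ha
      exact ⟨b, hb.symm⟩

lemma ar_dimTo {X Y Z B : C} {f : X ⟶ Y} {g : Y ⟶ Z} {h : Z ⟶ X⟦(1 : ℤ)⟧}
    (ar : IsARTriangle C f g h) (hB : Indec B) (h1 : ¬ Nonempty (B ≅ X))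
    (h2 : ¬ Nonempty (B ≅ X⟦(1 : ℤ)⟧)) :
    dimTo K homFin B (clsZero C X + clsZero C Z - clsZero C Y) = 0 := by
  have hd := ar.distinguished
  have := homFin Y B
  rw [map_sub, map_add, dimTo_cls, dimTo_cls, dimTo_cls,
    finrank_short_exact (Linear.leftComp K B g) (Linear.leftComp K B f) ?_ ?_ ?_]
  · push_cast; ring
  · rw [injective_iff_map_eq_zero]
    intro a ha
    change g ≫ a = 0 at ha
    obtain ⟨c, hc⟩ := dt_yo3 hd a ha
    have e : (B⟦(-1 : ℤ)⟧)⟦(1 : ℤ)⟧ ≅ B := shiftNegShift B 1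
    obtain ⟨c', hc'⟩ := (shiftFunctor C (1 : ℤ)).map_surjective (c ≫ e.inv)
    have : h ≫ c'⟦(1 : ℤ)⟧' = 0 := by
      apply ar_post_zero ar
      rintro ⟨r, hr⟩
      apply h2
      refine indec_iso_of_split hB (shift_ne_zero ar.indec₁.1 _) c (e.inv ≫ r⟦(1 : ℤ)⟧') ?_
      rw [← Category.assoc, ← hc', ← Functor.map_comp, hr, CategoryTheory.Functor.map_id]
    rw [hc', ← Category.assoc, ← hc] at this
    rw [← cancel_mono e.inv, this, zero_comp]
  · intro b
    exact ar.left_almost_split b (fun ⟨s, hs⟩ =>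
      h1 (indec_iso_of_split hB ar.indec₁.1 b s hs))
  · ext a
    constructor
    · rintro ⟨b, rfl⟩
      change f ≫ g ≫ b = 0
      rw [← Category.assoc, dt_comp12 hd, zero_comp]
    · intro ha
      obtain ⟨b, hb⟩ := dt_yo2 hd a ha
      exact ⟨b, hb.symm⟩

lemma closure_finite (x : K0Zero C) (hx : x ∈ AddSubgroup.closure (arRelTri C)) :
    ∃ l : List C, ∀ B : C, Indec B → (∀ A ∈ l, ¬ Nonempty (B ≅ A)) →
      dimFrom K homFin B x = 0 ∧ dimTo K homFin B x = 0 := by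
  induction hx using AddSubgroup.closure_induction with
  | mem x hx =>
    obtain ⟨X, Y, Z, f, g, h, ar, rfl⟩ := hx
    refine ⟨[Z, Z⟦(-1 : ℤ)⟧, X, X⟦(1 : ℤ)⟧], fun B hB hl => ⟨?_, ?_⟩⟩
    · exact ar_dimFrom K homFin ar hB (hl _ (by simp)) (hl _ (by simp))
    · exact ar_dimTo K homFin ar hB (hl _ (by simp)) (hl _ (by simp))
  | zero => exact ⟨[], fun B _ _ => by simp⟩
  | add x y _ _ hx hy =>
    obtain ⟨l, hl⟩ := hx
    obtain ⟨l', hl'⟩ := hy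
    refine ⟨l ++ l', fun B hB h => ?_⟩
    have a := hl B hB (fun A hA => h A (by simp [hA]))
    have b := hl' B hB (fun A hA => h A (by simp [hA]))
    simp [a.1, a.2, b.1, b.2]
  | neg x _ hx =>
    obtain ⟨l, hl⟩ := hx
    refine ⟨l, fun B hB h => ?_⟩
    have a := hl B hB h
    simp [a.1, a.2]

lemma closure_supp (homFin : ∀ X Y : C, FiniteDimensional K (X ⟶ Y))
    (A : C) (hx : clsZero C A + clsZero C (A⟦(1 : ℤ)⟧) - clsZero C (0 : C) ∈
      AddSubgroup.closure (arRelTri C)) :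
    ∃ l : List C, ∀ B : C, Indec B →
      ((∃ φ : A ⟶ B, φ ≠ 0) ∨ (∃ φ : B ⟶ A, φ ≠ 0) ∨ (∃ φ : A⟦(1 : ℤ)⟧ ⟶ B, φ ≠ 0) ∨
        (∃ φ : B ⟶ A⟦(1 : ℤ)⟧, φ ≠ 0)) → ∃ D ∈ l, Nonempty (B ≅ D) := by
  obtain ⟨l, hl⟩ := closure_finite K homFin _ hx
  refine ⟨l, fun B hB hne => ?_⟩
  by_contra hcon
  push Not at hcon
  obtain ⟨h1, h2⟩ := hl B hB (fun D hD hn => (not_nonempty_iff.2 (hcon D hD)) hn)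
  rw [map_sub, map_add, dimFrom_cls, dimFrom_cls, dimFrom_cls] at h1
  rw [map_sub, map_add, dimTo_cls, dimTo_cls, dimTo_cls] at h2
  have z1 : Module.finrank K (B ⟶ (0 : C)) = 0 := by
    have : Subsingleton (B ⟶ (0 : C)) := ⟨fun a b => (isZero_zero C).eq_of_tgt a b⟩
    exact Module.finrank_zero_of_subsingleton
  have z2 : Module.finrank K ((0 : C) ⟶ B) = 0 := by
    have : Subsingleton ((0 : C) ⟶ B) := ⟨fun a b => (isZero_zero C).eq_of_src a b⟩
    exact Module.finrank_zero_of_subsingleton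
  have van : ∀ {P Q : C}, Module.finrank K (P ⟶ Q) = 0 → ∀ φ : P ⟶ Q, φ = 0 := by
    intro P Q h φ
    have := homFin P Q
    have := Module.finrank_zero_iff.1 h
    exact Subsingleton.elim _ _
  rcases hne with ⟨φ, hφ⟩ | ⟨φ, hφ⟩ | ⟨φ, hφ⟩ | ⟨φ, hφ⟩
  · exact hφ (van (by omega) φ)
  · exact hφ (van (by omega) φ)
  · exact hφ (van (by omega) φ)
  · exact hφ (van (by omega) φ)

lemma list_to_fin {Pr : C → Prop} (l : List C) (h : ∀ B : C, Indec B → Pr B →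
    ∃ D ∈ l, Nonempty (B ≅ D)) :
    ∃ (n : ℕ) (ind : Fin n → C), ∀ B : C, Indec B → Pr B → ∃ i, Nonempty (B ≅ ind i) := by
  refine ⟨l.length, l.get, fun B hB hP => ?_⟩
  obtain ⟨D, hD, hn⟩ := h B hB hP
  obtain ⟨i, rfl⟩ := List.get_of_mem hD
  exact ⟨i, hn⟩

lemma dt_shift (A : C) :
    Triangle.mk (0 : A ⟶ (0 : C)) (0 : (0 : C) ⟶ A⟦(1 : ℤ)⟧) (𝟙 (A⟦(1 : ℤ)⟧)) ∈ distTriang C :=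
  contractible_distinguished₂ A

theorem conv_psi (homFin : ∀ X Y : C, FiniteDimensional K (X ⟶ Y))
    (hsub : triRel C ⊆ AddSubgroup.closure (arRelTri C)) : LocFinite C := by
  intro A _
  obtain ⟨l, hl⟩ := closure_supp K homFin A (hsub ⟨_, dt_shift A, rfl⟩)
  exact ⟨list_to_fin l (fun B hB h => hl B hB (Or.inl h)),
    list_to_fin l (fun B hB h => hl B hB (Or.inr (Or.inl h)))⟩

lemma exists_T_triangle {T : Set C} (hT : IsClusterTilting C T) (A : C) :
    ∃ (T₁ T₀ : C) (i : T₁ ⟶ T₀) (f : T₀ ⟶ A) (h : A ⟶ T₁⟦(1 : ℤ)⟧), T₁ ∈ T ∧ T₀ ∈ T ∧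
      Triangle.mk i f h ∈ distTriang C := by
  obtain ⟨T₀, hT₀, f, hf⟩ := hT.contravariantly_finite A
  obtain ⟨T₁, i, h, hd⟩ := distinguished_cocone_triangle₁ f
  refine ⟨T₁, T₀, i, f, h, ?_, hT₀, hd⟩
  rw [hT.char_left]
  intro t ht φ
  obtain ⟨b, hb⟩ := dt_co1 hd φ ((hT.char_left T₀).1 hT₀ t ht _)
  obtain ⟨b', hb'⟩ := hf t ht b
  rw [hb, ← hb', Category.assoc, dt_comp23 hd, comp_zero]

lemma arOff_subset (T : Set C) : arRelTriOff C T ⊆ arRelTri C := by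
  rintro x ⟨X, Y, Z, f, g, h, ar, -, rfl⟩
  exact ⟨X, Y, Z, f, g, h, ar, rfl⟩

theorem conv_g (homFin : ∀ X Y : C, FiniteDimensional K (X ⟶ Y))
    {T : Set C} (hT : IsClusterTilting C T)
    (hsub : relTriRel C T ⊆ AddSubgroup.closure (arRelTriOff C T)) : LocFinite C := by
  intro A _
  have key : ∀ t ∈ T, ∃ l : List C, ∀ B : C, Indec B →
      ((∃ φ : t ⟶ B, φ ≠ 0) ∨ (∃ φ : B ⟶ t, φ ≠ 0) ∨ (∃ φ : t⟦(1 : ℤ)⟧ ⟶ B, φ ≠ 0) ∨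
        (∃ φ : B ⟶ t⟦(1 : ℤ)⟧, φ ≠ 0)) → ∃ D ∈ l, Nonempty (B ≅ D) := by
    intro t ht
    exact closure_supp K homFin t (AddSubgroup.closure_mono (arOff_subset T)
      (hsub ⟨_, dt_shift t, ⟨t, ht, 𝟙 _, 𝟙 _, Category.comp_id _⟩, rfl⟩))
  obtain ⟨T₁, T₀, i, f, h, hT₁, hT₀, hd⟩ := exists_T_triangle hT A
  obtain ⟨l0, hl0⟩ := key T₀ hT₀
  obtain ⟨l1, hl1⟩ := key T₁ hT₁
  have comb : ∀ B : C, ((∃ D ∈ l0, Nonempty (B ≅ D)) ∨ (∃ D ∈ l1, Nonempty (B ≅ D))) →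
      ∃ D ∈ l0 ++ l1, Nonempty (B ≅ D) := by
    rintro B (⟨D, hD, hn⟩ | ⟨D, hD, hn⟩)
    · exact ⟨D, by simp [hD], hn⟩
    · exact ⟨D, by simp [hD], hn⟩
  constructor
  · apply list_to_fin (l0 ++ l1)
    rintro B hB ⟨φ, hφ⟩
    apply comb
    by_cases hz : f ≫ φ = 0
    · right
      obtain ⟨c, hc⟩ := dt_yo3 hd φ hz
      exact hl1 B hB (Or.inr (Or.inr (Or.inl ⟨c, by rintro rfl; apply hφ; rw [hc, comp_zero]⟩)))
    · left
      exact hl0 B hB (Or.inl ⟨_, hz⟩)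
  · apply list_to_fin (l0 ++ l1)
    rintro B hB ⟨φ, hφ⟩
    apply comb
    by_cases hz : φ ≫ h = 0
    · left
      obtain ⟨c, hc⟩ := dt_co3 hd φ hz
      exact hl0 B hB (Or.inr (Or.inl ⟨c, by rintro rfl; apply hφ; rw [hc, zero_comp]⟩))
    · right
      exact hl1 B hB (Or.inr (Or.inr (Or.inr ⟨_, hz⟩)))

lemma off_factors {T : Set C} (hT : IsClusterTilting C T) {V E U : C} {α : V ⟶ E} {β : E ⟶ U}
    {κ : U ⟶ V⟦(1 : ℤ)⟧} (ar : IsARTriangle C α β κ) (hV : V ∉ shiftSet C T) :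
    FactorsThruShift C T κ := by
  have hU : U ∉ T := by
    intro hU
    apply hV
    have e : (V⟦(-1 : ℤ)⟧)⟦(1 : ℤ)⟧ ≅ V := shiftNegShift V 1
    refine ⟨V⟦(-1 : ℤ)⟧, ?_, ⟨e.symm⟩⟩
    rw [hT.char_left]
    intro t ht φ
    by_contra hφ
    obtain ⟨W, p, x, hd⟩ := dt_cone (φ ≫ e.hom)
    have hne : φ ≫ e.hom ≠ 0 := by
      intro hz
      apply hφ
      rw [← cancel_mono e.hom, hz, zero_comp]
    have h1 : κ ≫ p⟦(1 : ℤ)⟧' = 0 := by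
      apply ar_post_zero ar
      rintro ⟨r, hr⟩
      apply hne
      calc φ ≫ e.hom = (φ ≫ e.hom) ≫ p ≫ r := by rw [hr, Category.comp_id]
        _ = 0 := by rw [← Category.assoc, dt_comp12 hd, zero_comp]
    have hrot : Triangle.mk p x (-((φ ≫ e.hom)⟦(1 : ℤ)⟧')) ∈ distTriang C :=
      rot_of_distTriang _ hd
    obtain ⟨b, hb⟩ := dt_co1 hrot κ h1
    apply ar_conn_ne ar
    rw [hb, (hT.char_left t).1 ht U hU b, zero_comp]
  obtain ⟨T₁, T₀, i, f, h, hT₁, hT₀, hd⟩ := exists_T_triangle hT U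
  have h1 : f ≫ κ = 0 := by
    apply ar_pre_zero ar
    rintro ⟨s, hs⟩
    obtain ⟨Q, j, p, spl⟩ := exists_spl s f hs
    exact hU (hT.summand_mem hT₀ spl.iso)
  obtain ⟨c, hc⟩ := dt_yo3 hd κ h1
  exact ⟨T₁, hT₁, h, c, hc.symm⟩

lemma factors_off {T : Set C} (hT : IsClusterTilting C T) {V E U : C} {α : V ⟶ E} {β : E ⟶ U}
    {κ : U ⟶ V⟦(1 : ℤ)⟧} (ar : IsARTriangle C α β κ) (hκ : FactorsThruShift C T κ) :
    V ∉ shiftSet C T := by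
  rintro ⟨t', ht', ⟨e⟩⟩
  obtain ⟨t, ht, a, b, hab⟩ := hκ
  obtain ⟨b', rfl⟩ := (shiftFunctor C (1 : ℤ)).map_surjective b
  have hz : b' ≫ e.hom = 0 := (hT.char_left t').1 ht' t ht _
  have hb' : b' = 0 := by rw [← cancel_mono e.hom, hz, zero_comp]
  apply ar_conn_ne ar
  rw [← hab, hb', Functor.map_zero, comp_zero]

end Conv2

theorem stmt11 (C : Type u) [Category.{v} C] [Preadditive C] [HasZeroObject C] [HasShift C ℤ]
    [∀ n : ℤ, (shiftFunctor C n).Additive] [Pretriangulated C] [HasFiniteBiproducts C]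
    (hKS : IsKrullSchmidt C) (K : Type w) [Field K] [Linear K C]
    (homFin : ∀ X Y : C, FiniteDimensional K (X ⟶ Y))
    (hAR : HasARTriangles C) (T : Set C) (hT : IsClusterTilting C T) :
    ((gProj C T).ker = AddSubgroup.closure (arRelTriOff C T) ↔ LocFinite C) ∧
    ((psiTri C).ker = AddSubgroup.closure (arRelTri C) ↔ LocFinite C) := by
  have kg : (gProj C T).ker = AddSubgroup.closure (relTriRel C T) := QuotientAddGroup.ker_mk' _
  have kp : (psiTri C).ker = AddSubgroup.closure (triRel C) := QuotientAddGroup.ker_mk' _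
  rw [kg, kp]
  refine ⟨⟨fun h => ?_, fun hL => ?_⟩, ⟨fun h => ?_, fun hL => ?_⟩⟩
  · exact conv_g K homFin hT (h ▸ AddSubgroup.subset_closure)
  · apply le_antisymm
    · rw [AddSubgroup.closure_le]
      refine (main_forward K homFin hKS hAR hL T).trans (AddSubgroup.closure_mono ?_)
      rintro x ⟨X, Y, Z, f, g, h, ar, hS, rfl⟩
      exact ⟨X, Y, Z, f, g, h, ar, factors_off hT ar hS, rfl⟩
    · apply AddSubgroup.closure_mono
      rintro x ⟨X, Y, Z, f, g, h, ar, hS, rfl⟩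
      exact ⟨_, ar.distinguished, off_factors hT ar hS, rfl⟩
  · exact conv_psi K homFin (h ▸ AddSubgroup.subset_closure)
  · apply le_antisymm
    · rw [AddSubgroup.closure_le]
      rintro x ⟨Tr, hTr, rfl⟩
      refine AddSubgroup.closure_mono ?_ (main_forward K homFin hKS hAR hL Set.univ
        ⟨Tr, hTr, ⟨Tr.obj₁, Set.mem_univ _, Tr.mor₃, 𝟙 _, Category.comp_id _⟩, rfl⟩)
      rintro x ⟨X, Y, Z, f, g, h, ar, -, rfl⟩
      exact ⟨X, Y, Z, f, g, h, ar, rfl⟩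
    · apply AddSubgroup.closure_mono
      rintro x ⟨X, Y, Z, f, g, h, ar, rfl⟩
      exact ⟨_, ar.distinguished, rfl⟩
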